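/- Let (X,Y) be a zero-mean jointly Gaussian random vector with X taking values in ℝ^{d_X}, Y in ℝ^{d_Y}, joint covariance matrix Σ ∈ ℝ^{(d_X+d_Y)×(d_X+d_Y)} and marginal covariance matrices Σ_X, Σ_Y. Let D be the set of all k ∈ ℕ such that, on some probability space, there exist random vectors (X̃,Ỹ) with the same joint law as (X,Y), a matrix G ∈ ℝ^{k×(d_X+d_Y)}, and an ℕ-valued random variable V with finite Shannon entropy, such that X̃ and Ỹ are conditionally independent given the σ-algebra generated by (V, G·[X̃;Ỹ]). Then D is nonempty and min D = rank(Σ_X) + rank(Σ_Y) − rank(Σ). Moreover, when Σ_X and Σ_Y are invertible, the minimum is attained with G·[X̃;Ỹ] = N_X X̃, where N = [N_X −N_Y] is any full-row-rank matrix whose rows form a basis of the left null space of Σ. -/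

import Mathlib

noncomputable section

open MeasureTheory ProbabilityTheory in
/-- A random vector is (jointly) Gaussian if every linear functional of it has a
(possibly degenerate) Gaussian distribution on `ℝ`. -/
def IsGaussianVec {Ω : Type*} [MeasurableSpace Ω] (P : Measure Ω) {ι : Type*} [Fintype ι]
    (Z : Ω → ι → ℝ) : Prop :=
  ∀ a : ι → ℝ, ∃ (m : ℝ) (v : NNReal),
    P.map (fun ω => ∑ i, a i * Z ω i) = gaussianReal m v

open MeasureTheory in
/-- Finite Shannon entropy of an `ℕ`-valued random variable:
`H(V) = ∑' n, -P(V = n) log P(V = n)` is finite. -/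
def HasFiniteEntropy {Ω : Type*} [MeasurableSpace Ω] (P : Measure Ω) (V : Ω → ℕ) : Prop :=
  Summable fun n => Real.negMulLog (P (V ⁻¹' {n})).toReal

open MeasureTheory in
/-- Conditional independence of two random vectors given a sub-σ-algebra `m`:
for all measurable sets `A`, `B`,
`E[1_{X ∈ A} 1_{Y ∈ B} | m] = E[1_{X ∈ A} | m] ⬝ E[1_{Y ∈ B} | m]` a.e. -/
def CondIndepRV {Ω : Type*} [MeasurableSpace Ω] (P : Measure Ω)
    (m : MeasurableSpace Ω) {α β : Type*} [MeasurableSpace α] [MeasurableSpace β]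
    (X : Ω → α) (Y : Ω → β) : Prop :=
  ∀ (A : Set α) (B : Set β), MeasurableSet A → MeasurableSet B →
    (P[((X ⁻¹' A) ∩ (Y ⁻¹' B)).indicator (fun _ => (1 : ℝ)) | m]) =ᵐ[P]
      fun ω => (P[(X ⁻¹' A).indicator (fun _ => (1 : ℝ)) | m]) ω *
        (P[(Y ⁻¹' B).indicator (fun _ => (1 : ℝ)) | m]) ω

/-- A witness that on some probability space there are random vectors `(X', Y')` with the
same joint law as `(X, Y)`, a matrix `G ∈ ℝ^{k × (dX + dY)}`, and an `ℕ`-valued random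
variable `V` of finite Shannon entropy, such that `X'` and `Y'` are conditionally
independent given the σ-algebra generated by `(V, G ⬝ [X'; Y'])`. -/
structure SimWitness {Ω : Type*} [MeasurableSpace Ω] (P : MeasureTheory.Measure Ω)
    {dX dY : ℕ} (X : Ω → Fin dX → ℝ) (Y : Ω → Fin dY → ℝ) (k : ℕ) : Type 1 where
  Ω' : Type
  [mΩ' : MeasurableSpace Ω']
  P' : MeasureTheory.Measure Ω'
  probP' : MeasureTheory.IsProbabilityMeasure P'
  X' : Ω' → Fin dX → ℝ
  Y' : Ω' → Fin dY → ℝ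
  V : Ω' → ℕ
  G : Matrix (Fin k) (Fin (dX + dY)) ℝ
  measX' : Measurable X'
  measY' : Measurable Y'
  measV : Measurable V
  sameLaw : P'.map (fun ω => (X' ω, Y' ω)) = P.map (fun ω => (X ω, Y ω))
  finEnt : HasFiniteEntropy P' V
  condIndep : CondIndepRV P'
    (MeasurableSpace.comap
      (fun ω => (V ω, G.mulVec (Fin.append (X' ω) (Y' ω)))) inferInstance)
    X' Y'

open MeasureTheory ProbabilityTheory Matrix

/-! ### Countable mixtures of product measures -/

/-- A measure on a product which is a countable sum of product measures whose total masses form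
a sequence of finite Shannon entropy. -/
def IsProductMixture {α β : Type*} [MeasurableSpace α] [MeasurableSpace β]
    (Γ : Measure (α × β)) : Prop :=
  ∃ (μ : ℕ → Measure α) (ν : ℕ → Measure β),
    (∀ v, IsFiniteMeasure (μ v)) ∧ (∀ v, IsFiniteMeasure (ν v)) ∧
    Γ = Measure.sum (fun v => (μ v).prod (ν v)) ∧
    Summable fun v => Real.negMulLog (μ v Set.univ * ν v Set.univ).toReal

namespace IsProductMixture

variable {α β : Type*} [MeasurableSpace α] [MeasurableSpace β]

lemma of_sum {ι : Type*} [Denumerable ι] {Γ : Measure (α × β)} [IsFiniteMeasure Γ]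
    {μ : ι → Measure α} {ν : ι → Measure β} [∀ i, SFinite (μ i)] [∀ i, SFinite (ν i)]
    (hΓ : Γ = Measure.sum (fun i => (μ i).prod (ν i)))
    (hw : Summable fun i => Real.negMulLog (μ i Set.univ * ν i Set.univ).toReal) :
    IsProductMixture Γ := by
  classical
  have hfin : ∀ i, μ i Set.univ * ν i Set.univ ≠ ⊤ := by
    intro i
    rw [← Measure.prod_prod, Set.univ_prod_univ]
    refine ne_top_of_le_ne_top (measure_ne_top Γ Set.univ) ?_
    rw [hΓ]
    exact Measure.le_sum (fun i => (μ i).prod (ν i)) i Set.univ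
  let e := (Denumerable.eqv ι).symm
  let z : ι → Prop := fun i => μ i Set.univ * ν i Set.univ = 0
  refine ⟨fun v => if z (e v) then 0 else μ (e v), fun v => if z (e v) then 0 else ν (e v),
    ?_, ?_, ?_, ?_⟩
  · intro v
    by_cases h : z (e v)
    · simp only [h, if_true]; infer_instance
    · simp only [h, if_false]
      refine ⟨lt_top_iff_ne_top.2 fun h' => hfin (e v) ?_⟩
      rw [h', ENNReal.top_mul (right_ne_zero_of_mul h)]
  · intro v
    by_cases h : z (e v)
    · simp only [h, if_true]; infer_instance
    · simp only [h, if_false]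
      refine ⟨lt_top_iff_ne_top.2 fun h' => hfin (e v) ?_⟩
      rw [h', ENNReal.mul_top (left_ne_zero_of_mul h)]
  · have hterm : ∀ i, (if z i then (0 : Measure α) else μ i).prod (if z i then 0 else ν i)
        = (μ i).prod (ν i) := by
      intro i
      by_cases h : z i
      · simp only [h, if_true]
        symm
        rw [Measure.prod_zero, ← Measure.measure_univ_eq_zero, ← Set.univ_prod_univ,
          Measure.prod_prod]
        exact h
      · simp [h]
    simp only [hterm]
    rw [hΓ]
    exact (Measure.sum_comp_equiv e (fun i => (μ i).prod (ν i))).symm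
  · have : (fun v => Real.negMulLog ((if z (e v) then (0 : Measure α) else μ (e v)) Set.univ *
        (if z (e v) then (0 : Measure β) else ν (e v)) Set.univ).toReal)
        = (fun i => Real.negMulLog (μ i Set.univ * ν i Set.univ).toReal) ∘ e := by
      funext v
      by_cases h : z (e v)
      · have h' : μ (e v) Set.univ * ν (e v) Set.univ = 0 := h
        simp only [h, if_true, Function.comp, h']
        simp
      · simp [h]
    rw [this]
    exact (Equiv.summable_iff e).2 hw

lemma map {α' β' : Type*} [MeasurableSpace α'] [MeasurableSpace β'] {Γ : Measure (α × β)}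
    (hΓ : IsProductMixture Γ) {φ : α → α'} {ψ : β → β'} (hφ : Measurable φ) (hψ : Measurable ψ) :
    IsProductMixture (Γ.map (Prod.map φ ψ)) := by
  obtain ⟨μ, ν, hμ, hν, rfl, hs⟩ := hΓ
  refine ⟨fun v => (μ v).map φ, fun v => (ν v).map ψ, fun v => inferInstance,
    fun v => inferInstance, ?_, ?_⟩
  · rw [Measure.map_sum (hφ.prodMap hψ).aemeasurable]
    congr 1
    funext v
    exact (Measure.map_prod_map _ _ hφ hψ).symm
  · simpa [Measure.map_apply hφ MeasurableSet.univ, Measure.map_apply hψ MeasurableSet.univ]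
      using hs

end IsProductMixture

lemma conv_prod_prod {E F : Type*} [NormedAddCommGroup E] [NormedSpace ℝ E] [CompleteSpace E]
    [MeasurableSpace E] [BorelSpace E] [SecondCountableTopology E]
    [NormedAddCommGroup F] [NormedSpace ℝ F] [CompleteSpace F]
    [MeasurableSpace F] [BorelSpace F] [SecondCountableTopology F]
    (μ μ' : Measure E) (ν ν' : Measure F) [IsFiniteMeasure μ] [IsFiniteMeasure μ']
    [IsFiniteMeasure ν] [IsFiniteMeasure ν'] :
    (μ.prod ν) ∗ (μ'.prod ν') = (μ ∗ μ').prod (ν ∗ ν') := by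
  apply Measure.ext_of_charFunDual
  funext L
  simp only [charFunDual_conv, charFunDual_prod]
  ring

lemma conv_univ {E : Type*} [AddMonoid E] [MeasurableSpace E] [MeasurableAdd₂ E]
    (μ ν : Measure E) [SFinite μ] [SFinite ν] :
    (μ ∗ ν) Set.univ = μ Set.univ * ν Set.univ := by
  rw [Measure.conv, Measure.map_apply measurable_add MeasurableSet.univ, Set.preimage_univ,
    ← Set.univ_prod_univ, Measure.prod_prod]

lemma summable_negMulLog_mul {ι κ : Type*} {p : ι → ℝ} {q : κ → ℝ} (hp0 : ∀ i, 0 ≤ p i)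
    (hq0 : ∀ i, 0 ≤ q i) (hp1 : ∀ i, p i ≤ 1) (hq1 : ∀ i, q i ≤ 1) (hp : Summable p)
    (hq : Summable q) (hP : Summable fun i => Real.negMulLog (p i))
    (hQ : Summable fun i => Real.negMulLog (q i)) :
    Summable fun x : ι × κ => Real.negMulLog (p x.1 * q x.2) := by
  have h1 := hP.mul_of_nonneg hq (fun i => Real.negMulLog_nonneg (hp0 i) (hp1 i)) hq0
  have h2 := hp.mul_of_nonneg hQ hp0 (fun i => Real.negMulLog_nonneg (hq0 i) (hq1 i))
  refine (h1.add h2).congr fun x => ?_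
  rw [Real.negMulLog_mul]
  ring

lemma IsProductMixture.conv {E F : Type*} [NormedAddCommGroup E] [NormedSpace ℝ E]
    [CompleteSpace E] [MeasurableSpace E] [BorelSpace E] [SecondCountableTopology E]
    [NormedAddCommGroup F] [NormedSpace ℝ F] [CompleteSpace F]
    [MeasurableSpace F] [BorelSpace F] [SecondCountableTopology F]
    {Γ Γ' : Measure (E × F)} [IsProbabilityMeasure Γ] [IsProbabilityMeasure Γ']
    (h : IsProductMixture Γ) (h' : IsProductMixture Γ') : IsProductMixture (Γ ∗ Γ') := by
  have key : ∀ (Γ : Measure (E × F)) [IsProbabilityMeasure Γ] (μ : ℕ → Measure E)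
      (ν : ℕ → Measure F), (∀ v, IsFiniteMeasure (μ v)) → (∀ v, IsFiniteMeasure (ν v)) →
      Γ = Measure.sum (fun v => (μ v).prod (ν v)) →
      (∀ v, (μ v Set.univ * ν v Set.univ).toReal ≤ 1) ∧
      Summable fun v => (μ v Set.univ * ν v Set.univ).toReal := by
    intro Γ _ μ ν _ _ hΓ
    have h1 : ∑' v, μ v Set.univ * ν v Set.univ = 1 := by
      rw [← measure_univ (μ := Γ), hΓ, Measure.sum_apply _ MeasurableSet.univ]
      congr 1
      funext v
      rw [← Set.univ_prod_univ, Measure.prod_prod]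
    refine ⟨fun v => ?_, ENNReal.summable_toReal (by simp [h1])⟩
    refine ENNReal.toReal_le_of_le_ofReal zero_le_one ?_
    rw [ENNReal.ofReal_one, ← h1]
    exact ENNReal.le_tsum v
  obtain ⟨μ, ν, hμ, hν, hΓ, hs⟩ := h
  obtain ⟨μ', ν', hμ', hν', hΓ', hs'⟩ := h'
  obtain ⟨h1, h2⟩ := key Γ μ ν hμ hν hΓ
  obtain ⟨h1', h2'⟩ := key Γ' μ' ν' hμ' hν' hΓ'
  refine IsProductMixture.of_sum (ι := ℕ × ℕ) (μ := fun x => μ x.1 ∗ μ' x.2)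
    (ν := fun x => ν x.1 ∗ ν' x.2) ?_ ?_
  · rw [Measure.conv, hΓ, hΓ', Measure.prod_sum, Measure.map_sum measurable_add.aemeasurable]
    congr 1
    funext x
    exact conv_prod_prod _ _ _ _
  · refine (summable_negMulLog_mul (fun _ => ENNReal.toReal_nonneg)
      (fun _ => ENNReal.toReal_nonneg) h1 h1' h2 h2' hs hs').congr fun x => ?_
    rw [conv_univ, conv_univ, ← ENNReal.toReal_mul]
    congr 2
    ring

lemma negMulLog_le_mul_add_exp {p : ℝ} (hp : 0 ≤ p) (c : ℝ) :
    Real.negMulLog p ≤ p * c + Real.exp (-c) := by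
  rcases hp.eq_or_lt with rfl | hp
  · simp [Real.exp_nonneg]
  have h := Real.log_le_sub_one_of_pos (div_pos (Real.exp_pos (-c)) hp)
  rw [Real.log_div (Real.exp_pos _).ne' hp.ne', Real.log_exp] at h
  have h' := mul_le_mul_of_nonneg_left h hp.le
  have : p * (Real.exp (-c) / p - 1) = Real.exp (-c) - p := by field_simp
  rw [this] at h'
  rw [Real.negMulLog_def]
  nlinarith

lemma summable_negMulLog_of_cost {ι : Type*} {p c : ι → ℝ} (hp0 : ∀ i, 0 ≤ p i)
    (hp1 : ∀ i, p i ≤ 1) (hc : Summable fun i => Real.exp (-c i))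
    (hpc : Summable fun i => p i * c i) : Summable fun i => Real.negMulLog (p i) :=
  Summable.of_nonneg_of_le (fun i => Real.negMulLog_nonneg (hp0 i) (hp1 i))
    (fun i => negMulLog_le_mul_add_exp (hp0 i) (c i)) (hpc.add hc)

lemma IsProductMixture.of_withDensity {α β ι : Type*} [MeasurableSpace α] [MeasurableSpace β]
    [Denumerable ι] {m₁ : Measure α} {m₂ : Measure β} [SFinite m₁] [SFinite m₂]
    {Γ : Measure (α × β)} [IsProbabilityMeasure Γ] {a : ι → α → ENNReal} {b : ι → β → ENNReal}
    (ha : ∀ i, Measurable (a i)) (hb : ∀ i, Measurable (b i))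
    (hΓ : Γ = (m₁.prod m₂).withDensity fun z => ∑' i, a i z.1 * b i z.2)
    {c : ι → ℝ} (hc0 : ∀ i, 0 ≤ c i) (hc : Summable fun i => Real.exp (-c i))
    (hfin : ∫⁻ z, ∑' i, ENNReal.ofReal (c i) * (a i z.1 * b i z.2) ∂(m₁.prod m₂) ≠ ⊤) :
    IsProductMixture Γ := by
  have hab : ∀ i, Measurable fun z : α × β => a i z.1 * b i z.2 := fun i =>
    ((ha i).comp measurable_fst).mul ((hb i).comp measurable_snd)
  have hsum : Γ = Measure.sum
      fun i => (m₁.withDensity (a i)).prod (m₂.withDensity (b i)) := by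
    simp_rw [fun i => prod_withDensity (μ := m₁) (ν := m₂) (ha i) (hb i)]
    rw [hΓ, ← withDensity_tsum hab]
    congr 1
    funext z
    rw [ENNReal.tsum_apply]
  have hmass : ∀ i, (m₁.withDensity (a i)) Set.univ * (m₂.withDensity (b i)) Set.univ
      = ∫⁻ z, a i z.1 * b i z.2 ∂(m₁.prod m₂) := by
    intro i
    rw [← Measure.prod_prod, prod_withDensity (ha i) (hb i), Set.univ_prod_univ,
      withDensity_apply _ MeasurableSet.univ, Measure.restrict_univ]
  have hle : ∀ i, (m₁.withDensity (a i)) Set.univ * (m₂.withDensity (b i)) Set.univ ≤ 1 := by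
    intro i
    rw [← Measure.prod_prod, Set.univ_prod_univ, ← measure_univ (μ := Γ), hsum]
    exact Measure.le_sum
      (fun i => (m₁.withDensity (a i)).prod (m₂.withDensity (b i))) i Set.univ
  refine IsProductMixture.of_sum hsum
    (summable_negMulLog_of_cost (fun _ => ENNReal.toReal_nonneg)
      (fun i => ENNReal.toReal_le_of_le_ofReal zero_le_one (by simpa using hle i)) hc ?_)
  rw [lintegral_tsum fun i => ((hab i).const_mul _).aemeasurable] at hfin
  refine (ENNReal.summable_toReal hfin).congr fun i => ?_
  rw [lintegral_const_mul _ (hab i), ENNReal.toReal_mul, ENNReal.toReal_ofReal (hc0 i), hmass,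
    mul_comm]

lemma hasSum_poisson (A : ℝ) :
    HasSum (fun n : ℕ => Real.exp (-A) * (A ^ n / n.factorial)) 1 := by
  have h := (NormedSpace.expSeries_div_hasSum_exp A).mul_left (Real.exp (-A))
  rwa [← Real.exp_eq_exp_ℝ, ← Real.exp_add, neg_add_cancel, Real.exp_zero] at h

lemma hasSum_poisson_mean (A : ℝ) :
    HasSum (fun n : ℕ => (n : ℝ) * (Real.exp (-A) * (A ^ n / n.factorial))) A := by
  have h := (hasSum_poisson A).mul_left A
  rw [mul_one] at h
  rw [← hasSum_nat_add_iff' 1]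
  simp only [Finset.range_one, Finset.sum_singleton, Nat.cast_zero, zero_mul, sub_zero]
  refine h.congr_fun fun n => ?_
  rw [Nat.factorial_succ]
  have : (n.factorial : ℝ) ≠ 0 := by positivity
  push_cast
  field_simp
  ring

lemma ENNReal.tsum_ofReal_eq {ι : Type*} {f : ι → ℝ} {s : ℝ} (hf : ∀ i, 0 ≤ f i)
    (h : HasSum f s) : ∑' i, ENNReal.ofReal (f i) = ENNReal.ofReal s := by
  rw [← ENNReal.ofReal_tsum_of_nonneg hf h.summable, h.tsum_eq]

lemma ENNReal.tsum_triple {ι₁ ι₂ ι₃ : Type*} (f : ι₁ → ENNReal) (g : ι₂ → ENNReal)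
    (h : ι₃ → ENNReal) :
    ∑' i : ι₁ × ι₂ × ι₃, f i.1 * (g i.2.1 * h i.2.2) = (∑' i, f i) * ((∑' i, g i) * ∑' i, h i) := by
  rw [ENNReal.tsum_prod (f := fun i (j : ι₂ × ι₃) => f i * (g j.1 * h j.2))]
  simp_rw [ENNReal.tsum_mul_left]
  rw [ENNReal.tsum_mul_right]
  congr 1
  rw [ENNReal.tsum_prod (f := fun i j => g i * h j)]
  simp_rw [ENNReal.tsum_mul_left]
  rw [ENNReal.tsum_mul_right]

lemma ENNReal.tsum_triple_add {ι₁ ι₂ ι₃ : Type*} {f f' : ι₁ → ENNReal} {g g' : ι₂ → ENNReal}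
    {h h' : ι₃ → ENNReal} (hf : ∑' i, f i = 1) (hg : ∑' i, g i = 1) (hh : ∑' i, h i = 1) :
    ∑' i : ι₁ × ι₂ × ι₃, (f' i.1 + (g' i.2.1 + h' i.2.2)) * (f i.1 * (g i.2.1 * h i.2.2))
      = ∑' i, f' i * f i + (∑' i, g' i * g i + ∑' i, h' i * h i) := by
  have e1 := ENNReal.tsum_triple (fun i => f' i * f i) g h
  have e2 := ENNReal.tsum_triple f (fun i => g' i * g i) h
  have e3 := ENNReal.tsum_triple f g (fun i => h' i * h i)
  rw [hg, hh, mul_one, mul_one] at e1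
  rw [hf, hh, mul_one, one_mul] at e2
  rw [hf, hg, one_mul, one_mul] at e3
  rw [← e1, ← e2, ← e3, ← ENNReal.tsum_add, ← ENNReal.tsum_add]
  congr 1
  funext i
  ring

lemma summable_exp_neg_abs_int : Summable fun j : ℤ => Real.exp (-|(j : ℝ)|) := by
  rw [summable_int_iff_summable_nat_and_neg]
  simpa using Real.summable_exp_neg_nat

lemma summable_exp_neg_triple :
    Summable fun i : ℤ × ℕ × ℕ => Real.exp (-(|(i.1 : ℝ)| + (i.2.1 + i.2.2))) := by
  have h := summable_exp_neg_abs_int.mul_of_nonneg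
    (Real.summable_exp_neg_nat.mul_of_nonneg Real.summable_exp_neg_nat
      (fun _ => Real.exp_nonneg _) (fun _ => Real.exp_nonneg _))
    (fun _ => Real.exp_nonneg _) (fun _ => mul_nonneg (Real.exp_nonneg _) (Real.exp_nonneg _))
  refine h.congr fun i => ?_
  rw [← Real.exp_add, ← Real.exp_add]
  congr 1
  ring

/-! ### Pairs of correlated standard Gaussian variables -/

/-- The law of a pair of standard Gaussian variables with correlation `ρ`. -/
def corrGaussian (ρ : ℝ) : Measure (ℝ × ℝ) :=
  ((gaussianReal 0 1).prod (gaussianReal 0 1)).map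
    (fun z => (z.1, ρ * z.1 + √(1 - ρ ^ 2) * z.2))

instance (ρ : ℝ) : IsProbabilityMeasure (corrGaussian ρ) :=
  Measure.isProbabilityMeasure_map (by fun_prop)

lemma charFunDual_stdGaussianReal (L : StrongDual ℝ ℝ) :
    charFunDual (gaussianReal 0 1) L = Complex.exp (-((L 1) ^ 2 : ℝ) / 2) := by
  have h := charFun_gaussianReal (μ := 0) (v := 1) (L 1)
  rw [charFun_apply_real] at h
  rw [charFunDual_apply]
  have hL : ∀ x : ℝ, L x = L 1 * x := fun x => by
    have := L.map_smul x 1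
    simp only [smul_eq_mul, mul_one] at this
    rw [this, mul_comm]
  have hfun : (fun x => Complex.exp (L x * Complex.I))
      = fun x : ℝ => Complex.exp ((L 1 : ℝ) * x * Complex.I) := by
    funext x
    rw [hL x, Complex.ofReal_mul]
  rw [hfun, h]
  congr 1
  push_cast
  simp
  ring

lemma charFunDual_corrGaussian {ρ : ℝ} (hρ : ρ ^ 2 ≤ 1) (L : StrongDual ℝ (ℝ × ℝ)) :
    charFunDual (corrGaussian ρ) L = Complex.exp
      (-(((L (1, 0)) ^ 2 + (L (0, 1)) ^ 2 + 2 * ρ * (L (1, 0) * L (0, 1)) : ℝ) : ℂ) / 2) := by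
  let T : ℝ × ℝ →L[ℝ] ℝ × ℝ := (ContinuousLinearMap.fst ℝ ℝ ℝ).prod
    (ρ • ContinuousLinearMap.fst ℝ ℝ ℝ + √(1 - ρ ^ 2) • ContinuousLinearMap.snd ℝ ℝ ℝ)
  have hT : (fun z : ℝ × ℝ => (z.1, ρ * z.1 + √(1 - ρ ^ 2) * z.2)) = T := by
    funext z
    simp [T]
  have hL : ∀ x y : ℝ, L (x, y) = x * L (1, 0) + y * L (0, 1) := by
    intro x y
    have : ((x, y) : ℝ × ℝ) = x • (1, 0) + y • (0, 1) := by simp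
    rw [this, map_add, map_smul, map_smul, smul_eq_mul, smul_eq_mul]
  rw [corrGaussian, hT, charFunDual_map, charFunDual_prod, charFunDual_stdGaussianReal,
    charFunDual_stdGaussianReal, ← Complex.exp_add]
  congr 1
  have hσ : √(1 - ρ ^ 2) ^ 2 = 1 - ρ ^ 2 := Real.sq_sqrt (by linarith)
  simp only [ContinuousLinearMap.comp_apply, ContinuousLinearMap.inl_apply,
    ContinuousLinearMap.inr_apply, ← hT]
  have e1 : L (1, ρ * 1 + √(1 - ρ ^ 2) * 0) = L (1, 0) + ρ * L (0, 1) := by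
    rw [hL]
    ring
  have e2 : L (0, ρ * 0 + √(1 - ρ ^ 2) * 1) = √(1 - ρ ^ 2) * L (0, 1) := by
    rw [hL]
    ring
  rw [e1, e2]
  simp only [← Complex.ofReal_neg, ← Complex.ofReal_ofNat, ← Complex.ofReal_div,
    ← Complex.ofReal_add]
  congr 1
  rw [mul_pow, hσ]
  ring

lemma corrGaussian_eq_withDensity {ρ : ℝ} (hρ : ρ ^ 2 < 1) :
    corrGaussian ρ = (volume.prod volume).withDensity fun z : ℝ × ℝ =>
      gaussianPDF 0 1 z.1 * gaussianPDF (ρ * z.1) (1 - ρ ^ 2).toNNReal z.2 := by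
  have hs : (1 - ρ ^ 2).toNNReal ≠ 0 := by simpa using hρ
  have hmeas : Measurable fun z : ℝ × ℝ => gaussianPDF (ρ * z.1) (1 - ρ ^ 2).toNNReal z.2 := by
    simp only [gaussianPDF_def, gaussianPDFReal_def]
    fun_prop
  have hmeas' : Measurable fun z : ℝ × ℝ =>
      gaussianPDF 0 1 z.1 * gaussianPDF (ρ * z.1) (1 - ρ ^ 2).toNNReal z.2 :=
    ((measurable_gaussianPDF 0 1).comp measurable_fst).mul hmeas
  have hlaw : ∀ x : ℝ, (gaussianReal 0 1).map (fun n => ρ * x + √(1 - ρ ^ 2) * n)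
      = volume.withDensity (gaussianPDF (ρ * x) (1 - ρ ^ 2).toNNReal) := by
    intro x
    rw [← gaussianReal_of_var_ne_zero _ hs]
    have : (fun n : ℝ => ρ * x + √(1 - ρ ^ 2) * n)
        = (fun n => ρ * x + n) ∘ fun n => √(1 - ρ ^ 2) * n := rfl
    rw [this, ← Measure.map_map (by fun_prop) (by fun_prop), gaussianReal_map_const_mul,
      gaussianReal_map_const_add]
    congr 1
    · simp
    · ext
      simp [Real.sq_sqrt (by linarith : 0 ≤ 1 - ρ ^ 2), hρ.le]
  ext S hS
  have hf : Measurable fun z : ℝ × ℝ => (z.1, ρ * z.1 + √(1 - ρ ^ 2) * z.2) := by fun_prop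
  rw [corrGaussian, Measure.map_apply hf hS, Measure.prod_apply (hf hS), withDensity_apply _ hS,
    ← lintegral_indicator hS, lintegral_prod _ (hmeas'.indicator hS).aemeasurable,
    gaussianReal_of_var_ne_zero 0 one_ne_zero,
    lintegral_withDensity_eq_lintegral_mul _ (measurable_gaussianPDF 0 1)]
  · congr 1
    funext x
    have hSx : MeasurableSet (Prod.mk x ⁻¹' S) := measurable_prodMk_left hS
    rw [← gaussianReal_of_var_ne_zero 0 one_ne_zero]
    have h1 : Prod.mk x ⁻¹' ((fun z : ℝ × ℝ => (z.1, ρ * z.1 + √(1 - ρ ^ 2) * z.2)) ⁻¹' S)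
        = (fun n => ρ * x + √(1 - ρ ^ 2) * n) ⁻¹' (Prod.mk x ⁻¹' S) := rfl
    rw [Pi.mul_apply, h1, ← Measure.map_apply (by fun_prop) hSx, hlaw, withDensity_apply _ hSx,
      ← lintegral_const_mul _ (measurable_gaussianPDF _ _), ← lintegral_indicator hSx]
    rfl
  · exact measurable_measure_prodMk_left (hf hS)

/-- Exponential tilt of a unit cell, expanded as a Poisson mixture of products. -/
lemma gaussianDensity_mul_poisson {ρ s : ℝ} (hs : 0 < s) (x y j : ℝ) (n k : ℕ) :
    Real.exp (-x ^ 2 / 2) * Real.exp (-(y - ρ * x) ^ 2 / (2 * s)) *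
      ((Real.exp (-(ρ / s * (x - j) * max y 0)) *
          ((ρ / s * (x - j) * max y 0) ^ n / n.factorial)) *
        (Real.exp (-(ρ / s * (1 - (x - j)) * max (-y) 0)) *
          ((ρ / s * (1 - (x - j)) * max (-y) 0) ^ k / k.factorial))) =
    (Real.exp (-x ^ 2 / 2 - ρ ^ 2 * x ^ 2 / (2 * s)) *
        ((x - j) ^ n / n.factorial * ((1 - (x - j)) ^ k / k.factorial))) *
      (Real.exp (-y ^ 2 / (2 * s) + ρ / s * (j * y - max (-y) 0)) *
        ((ρ / s * max y 0) ^ n * (ρ / s * max (-y) 0) ^ k)) := by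
  have hy : y = max y 0 - max (-y) 0 := by
    rcases le_total 0 y with h | h <;> simp [h]
  have hexp : Real.exp (-x ^ 2 / 2) * Real.exp (-(y - ρ * x) ^ 2 / (2 * s)) *
      (Real.exp (-(ρ / s * (x - j) * max y 0)) *
        Real.exp (-(ρ / s * (1 - (x - j)) * max (-y) 0))) =
      Real.exp (-x ^ 2 / 2 - ρ ^ 2 * x ^ 2 / (2 * s)) *
        Real.exp (-y ^ 2 / (2 * s) + ρ / s * (j * y - max (-y) 0)) := by
    simp only [← Real.exp_add]
    congr 1
    generalize max y 0 = p at *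
    generalize max (-y) 0 = q at *
    subst hy
    field_simp
    ring
  calc _ = (Real.exp (-x ^ 2 / 2) * Real.exp (-(y - ρ * x) ^ 2 / (2 * s)) *
      (Real.exp (-(ρ / s * (x - j) * max y 0)) *
        Real.exp (-(ρ / s * (1 - (x - j)) * max (-y) 0)))) *
      (((x - j) ^ n / n.factorial * ((1 - (x - j)) ^ k / k.factorial)) *
        ((ρ / s * max y 0) ^ n * (ρ / s * max (-y) 0) ^ k)) := by
        simp only [mul_pow]
        ring
    _ = _ := by
        rw [hexp]
        ring

lemma integrable_id_corrGaussian (ρ : ℝ) : Integrable id (corrGaussian ρ) := by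
  let T : ℝ × ℝ →L[ℝ] ℝ × ℝ := (ContinuousLinearMap.fst ℝ ℝ ℝ).prod
    (ρ • ContinuousLinearMap.fst ℝ ℝ ℝ + √(1 - ρ ^ 2) • ContinuousLinearMap.snd ℝ ℝ ℝ)
  have hT : (fun z : ℝ × ℝ => (z.1, ρ * z.1 + √(1 - ρ ^ 2) * z.2)) = T := by
    funext z
    simp [T]
  rw [corrGaussian, hT]
  exact IsGaussian.integrable_id

/-- Two correlated standard Gaussian variables are conditionally independent given a countably
valued variable of finite entropy. -/
lemma isProductMixture_corrGaussian {ρ : ℝ} (hρ0 : 0 < ρ) (hρ1 : ρ < 1) :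
    IsProductMixture (corrGaussian ρ) := by
  have hρ : ρ ^ 2 < 1 := by nlinarith
  set s : ℝ := 1 - ρ ^ 2 with hs_def
  have hs : 0 < s := by linarith
  have ht : 0 < ρ / s := by positivity
  set C : ℝ := (√(2 * Real.pi))⁻¹ * (√(2 * Real.pi * s))⁻¹ with hC
  have hC0 : 0 ≤ C := by positivity
  let d : ℝ × ℝ → ENNReal := fun z => gaussianPDF 0 1 z.1 * gaussianPDF (ρ * z.1) s.toNNReal z.2
  have hd : ∀ z, d z = ENNReal.ofReal
      (C * (Real.exp (-z.1 ^ 2 / 2) * Real.exp (-(z.2 - ρ * z.1) ^ 2 / (2 * s)))) := by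
    intro z
    simp only [d, gaussianPDF, gaussianPDFReal]
    rw [← ENNReal.ofReal_mul (by positivity)]
    congr 1
    simp only [NNReal.coe_one, mul_one, sub_zero, Real.coe_toNNReal s hs.le, C]
    ring
  have hdmeas : Measurable d := by
    have : d = _ := funext hd
    rw [this]
    fun_prop
  have hdens : corrGaussian ρ = (volume.prod volume).withDensity d :=
    corrGaussian_eq_withDensity hρ
  let a : ℤ × ℕ × ℕ → ℝ → ENNReal := fun i => {x : ℝ | ⌊x⌋ = i.1}.indicator fun x =>
    ENNReal.ofReal (C * (Real.exp (-x ^ 2 / 2 - ρ ^ 2 * x ^ 2 / (2 * s)) *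
      ((x - i.1) ^ i.2.1 / i.2.1.factorial * ((1 - (x - i.1)) ^ i.2.2 / i.2.2.factorial))))
  let b : ℤ × ℕ × ℕ → ℝ → ENNReal := fun i y => ENNReal.ofReal
    (Real.exp (-y ^ 2 / (2 * s) + ρ / s * (i.1 * y - max (-y) 0)) *
      ((ρ / s * max y 0) ^ i.2.1 * (ρ / s * max (-y) 0) ^ i.2.2))
  let A : ℝ × ℝ → ℝ := fun z => ρ / s * Int.fract z.1 * max z.2 0
  let B : ℝ × ℝ → ℝ := fun z => ρ / s * (1 - Int.fract z.1) * max (-z.2) 0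
  have hA0 : ∀ z, 0 ≤ A z := fun z =>
    mul_nonneg (mul_nonneg ht.le (Int.fract_nonneg _)) (le_max_right _ _)
  have hB0 : ∀ z, 0 ≤ B z := fun z =>
    mul_nonneg (mul_nonneg ht.le (by linarith [Int.fract_lt_one z.1])) (le_max_right _ _)
  let q : ℝ → ℕ → ℝ := fun A n => Real.exp (-A) * (A ^ n / n.factorial)
  have hq0 : ∀ A, 0 ≤ A → ∀ n, 0 ≤ q A n := fun A hA n => by positivity
  have hab : ∀ z i, a i z.1 * b i z.2 = d z * ((if i.1 = ⌊z.1⌋ then 1 else 0) *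
      (ENNReal.ofReal (q (A z) i.2.1) * ENNReal.ofReal (q (B z) i.2.2))) := by
    intro z i
    by_cases hi : ⌊z.1⌋ = i.1
    · have hu : z.1 - i.1 = Int.fract z.1 := by rw [← hi]; rfl
      have hu0 := Int.fract_nonneg z.1
      have hu1 : 0 ≤ 1 - Int.fract z.1 := by linarith [Int.fract_lt_one z.1]
      rw [← hu] at hu0 hu1
      rw [if_pos hi.symm, one_mul, hd]
      simp only [a, b]
      rw [Set.indicator_of_mem (show z.1 ∈ {x : ℝ | ⌊x⌋ = i.1} from hi),
        ← ENNReal.ofReal_mul (by positivity), ← ENNReal.ofReal_mul (hq0 _ (hA0 z) _),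
        ← ENNReal.ofReal_mul (by positivity)]
      congr 1
      rw [mul_assoc C, ← gaussianDensity_mul_poisson hs]
      simp only [q, A, B, hu, mul_assoc]
    · simp only [a]
      rw [Set.indicator_of_notMem (show z.1 ∉ {x : ℝ | ⌊x⌋ = i.1} from hi), if_neg (Ne.symm hi)]
      simp
  have h1 : ∀ z : ℝ × ℝ, ∑' j : ℤ, (if j = ⌊z.1⌋ then (1 : ENNReal) else 0) = 1 :=
    fun z => tsum_ite_eq _ _
  have h2 : ∀ A, 0 ≤ A → ∑' n, ENNReal.ofReal (q A n) = 1 := fun A hA => by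
    rw [ENNReal.tsum_ofReal_eq (hq0 A hA) (hasSum_poisson A), ENNReal.ofReal_one]
  have h3 : ∀ A, 0 ≤ A → ∑' n : ℕ, ENNReal.ofReal n * ENNReal.ofReal (q A n)
      = ENNReal.ofReal A := fun A hA => by
    simp_rw [← ENNReal.ofReal_mul (Nat.cast_nonneg _)]
    exact ENNReal.tsum_ofReal_eq (fun n => mul_nonneg (Nat.cast_nonneg _) (hq0 A hA n))
      (hasSum_poisson_mean A)
  have hsum : ∀ z, ∑' i, a i z.1 * b i z.2 = d z := by
    intro z
    simp_rw [hab, ENNReal.tsum_mul_left]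
    rw [ENNReal.tsum_triple (fun j => if j = ⌊z.1⌋ then (1 : ENNReal) else 0)
      (fun n => ENNReal.ofReal (q (A z) n)) (fun n => ENNReal.ofReal (q (B z) n)), h1,
      h2 _ (hA0 z), h2 _ (hB0 z)]
    simp
  have hcost : ∀ z, ∑' i : ℤ × ℕ × ℕ,
      ENNReal.ofReal (|(i.1 : ℝ)| + (i.2.1 + i.2.2)) * (a i z.1 * b i z.2)
      = d z * (ENNReal.ofReal |(⌊z.1⌋ : ℝ)| + (ENNReal.ofReal (A z) + ENNReal.ofReal (B z))) := by
    intro z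
    have h := ENNReal.tsum_triple_add (f' := fun j : ℤ => ENNReal.ofReal |(j : ℝ)|)
      (g' := fun n : ℕ => ENNReal.ofReal n) (h' := fun n : ℕ => ENNReal.ofReal n)
      (h1 z) (h2 _ (hA0 z)) (h2 _ (hB0 z))
    rw [h3 _ (hA0 z), h3 _ (hB0 z)] at h
    simp only [mul_ite, mul_one, mul_zero, tsum_ite_eq] at h
    rw [← h, ← ENNReal.tsum_mul_left]
    refine tsum_congr fun i => ?_
    rw [hab, ENNReal.ofReal_add (abs_nonneg _) (by positivity),
      ENNReal.ofReal_add (Nat.cast_nonneg _) (Nat.cast_nonneg _)]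
    split_ifs <;> ring
  have hint : Integrable (fun z : ℝ × ℝ => |z.1| + 1 + ρ / s * |z.2|) (corrGaussian ρ) :=
    ((integrable_id_corrGaussian ρ).fst.abs.add (integrable_const 1)).add
      ((integrable_id_corrGaussian ρ).snd.abs.const_mul _)
  refine IsProductMixture.of_withDensity (a := a) (b := b) (m₁ := volume) (m₂ := volume)
    (fun i => ?_) (fun i => ?_) ?_ (c := fun i => |(i.1 : ℝ)| + (i.2.1 + i.2.2))
    (fun i => by positivity) summable_exp_neg_triple ?_
  · exact Measurable.indicator (by fun_prop) (Int.measurable_floor (measurableSet_singleton _))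
  · fun_prop
  · simp_rw [hsum]
    exact hdens
  · simp_rw [hcost]
    refine ne_top_of_le_ne_top hint.lintegral_lt_top.ne ?_
    rw [hdens, lintegral_withDensity_eq_lintegral_mul _ hdmeas (by fun_prop)]
    refine lintegral_mono fun z => mul_le_mul_right ?_ _
    rw [← ENNReal.ofReal_add (hA0 z) (hB0 z),
      ← ENNReal.ofReal_add (abs_nonneg _) (add_nonneg (hA0 z) (hB0 z))]
    refine ENNReal.ofReal_le_ofReal ?_
    have hu0 := Int.fract_nonneg z.1
    have hu1 := (Int.fract_lt_one z.1).le
    have hfl : |(⌊z.1⌋ : ℝ)| ≤ |z.1| + 1 := by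
      have : (⌊z.1⌋ : ℝ) = z.1 - Int.fract z.1 := (Int.self_sub_fract z.1).symm
      rw [this]
      refine (abs_sub _ _).trans ?_
      rw [abs_of_nonneg hu0]
      linarith
    have hAB : A z + B z ≤ ρ / s * |z.2| := by
      have : A z + B z = ρ / s * (Int.fract z.1 * max z.2 0 +
        (1 - Int.fract z.1) * max (-z.2) 0) := by simp only [A, B]; ring
      rw [this]
      refine mul_le_mul_of_nonneg_left ?_ ht.le
      rcases le_total 0 z.2 with h | h
      · rw [max_eq_left h, max_eq_right (by linarith), abs_of_nonneg h]
        nlinarith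
      · rw [max_eq_right h, max_eq_left (by linarith), abs_of_nonpos h]
        nlinarith
    linarith

lemma isProductMixture_dirac {α β : Type*} [MeasurableSpace α] [MeasurableSpace β] (x : α) (y : β) :
    IsProductMixture (Measure.dirac (x, y)) := by
  refine ⟨fun v => if v = 0 then Measure.dirac x else 0, fun _ => Measure.dirac y,
    fun v => ?_, fun v => inferInstance, ?_, ?_⟩
  · dsimp only
    split_ifs <;> infer_instance
  · ext S hS
    rw [Measure.sum_apply _ hS, tsum_eq_single 0]
    · simp [Measure.dirac_prod_dirac]
    · intro v hv
      simp [hv]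
  · refine summable_of_hasFiniteSupport ((Set.finite_singleton 0).subset fun v hv => ?_)
    by_contra h
    simp at h
    simp [h] at hv

/-- A sum of independent pairs `(ξ • c, η • d)`, with `(ξ, η)` standard Gaussian variables of
correlation `ρ`, is a mixture of products with finite entropy. -/
lemma exists_isProductMixture_charFunDual {ι E F : Type*} [NormedAddCommGroup E] [NormedSpace ℝ E]
    [CompleteSpace E] [MeasurableSpace E] [BorelSpace E] [SecondCountableTopology E]
    [NormedAddCommGroup F] [NormedSpace ℝ F] [CompleteSpace F]
    [MeasurableSpace F] [BorelSpace F] [SecondCountableTopology F]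
    {ρ : ℝ} (hρ0 : 0 < ρ) (hρ1 : ρ < 1) (c : ι → E) (d : ι → F) (S : Finset ι) :
    ∃ Γ : Measure (E × F), IsProbabilityMeasure Γ ∧ IsProductMixture Γ ∧
      ∀ L : StrongDual ℝ (E × F), charFunDual Γ L = Complex.exp (-((∑ l ∈ S, ((L (c l, 0)) ^ 2
        + (L (0, d l)) ^ 2 + 2 * ρ * (L (c l, 0) * L (0, d l))) : ℝ) : ℂ) / 2) := by
  classical
  induction S using Finset.induction_on with
  | empty => exact ⟨Measure.dirac (0, 0), inferInstance, isProductMixture_dirac 0 0, fun L => by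
      simp [charFunDual_dirac, ← Prod.zero_eq_mk]⟩
  | insert l S hl ih =>
    obtain ⟨Γ, hΓ, hmix, hchar⟩ := ih
    let φ : ℝ →L[ℝ] E := (ContinuousLinearMap.id ℝ ℝ).smulRight (c l)
    let ψ : ℝ →L[ℝ] F := (ContinuousLinearMap.id ℝ ℝ).smulRight (d l)
    have hT : Prod.map φ ψ = φ.prodMap ψ := rfl
    have : IsProbabilityMeasure ((corrGaussian ρ).map (Prod.map φ ψ)) :=
      Measure.isProbabilityMeasure_map (by fun_prop)
    refine ⟨(corrGaussian ρ).map (Prod.map φ ψ) ∗ Γ, inferInstance, ?_, fun L => ?_⟩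
    · exact ((isProductMixture_corrGaussian hρ0 hρ1).map φ.continuous.measurable
        ψ.continuous.measurable).conv hmix
    · rw [charFunDual_conv, hchar, hT, charFunDual_map,
        charFunDual_corrGaussian (by nlinarith), ← Complex.exp_add, Finset.sum_insert hl]
      congr 1
      have e1 : φ.prodMap ψ (1, 0) = (c l, 0) := by simp [φ, ψ]
      have e2 : φ.prodMap ψ (0, 1) = (0, d l) := by simp [φ, ψ]
      rw [ContinuousLinearMap.comp_apply, ContinuousLinearMap.comp_apply, e1, e2]
      push_cast
      ring

/-! ### Conditional independence from a kernel -/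

lemma condExp_indicator_compProd {β γ : Type*} [MeasurableSpace β] [MeasurableSpace γ]
    (π : Measure β) [IsProbabilityMeasure π] (η : Kernel β γ) [IsMarkovKernel η]
    {S : Set (β × γ)} (hS : MeasurableSet S) :
    (π ⊗ₘ η)[S.indicator (fun _ => (1 : ℝ)) | MeasurableSpace.comap Prod.fst inferInstance]
      =ᵐ[π ⊗ₘ η] fun w => (η w.1 (Prod.mk w.1 ⁻¹' S)).toReal := by
  have hm := (measurable_fst : Measurable (Prod.fst : β × γ → β)).comap_le
  have hg : Measurable fun b => η b (Prod.mk b ⁻¹' S) := η.measurable_kernel_prodMk_left hS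
  have hg' : Measurable fun w : β × γ => η w.1 (Prod.mk w.1 ⁻¹' S) := hg.comp measurable_fst
  have hgint : Integrable (fun w : β × γ => (η w.1 (Prod.mk w.1 ⁻¹' S)).toReal) (π ⊗ₘ η) := by
    refine integrable_toReal_of_lintegral_ne_top hg'.aemeasurable ?_
    refine ne_top_of_le_ne_top ENNReal.one_ne_top ?_
    refine (lintegral_mono (g := fun _ => 1) fun w => prob_le_one).trans ?_
    simp
  refine (ae_eq_condExp_of_forall_setIntegral_eq hm ?_ ?_ ?_ ?_).symm
  · exact (integrable_const 1).indicator hS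
  · exact fun s _ _ => hgint.integrableOn
  · rintro s ⟨B, hB, rfl⟩ -
    have hB' : MeasurableSet (Prod.fst ⁻¹' B : Set (β × γ)) := measurable_fst hB
    rw [integral_toReal hg'.aemeasurable
      (Filter.Eventually.of_forall fun w => measure_lt_top _ _), integral_indicator hS,
      Measure.restrict_restrict hS, setIntegral_const, smul_eq_mul, mul_one, measureReal_def,
      Measure.compProd_apply (hS.inter hB'), ← lintegral_indicator hB',
      Measure.lintegral_compProd (hg'.indicator hB')]
    congr 1
    refine lintegral_congr fun b => ?_
    by_cases hb : b ∈ B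
    · have h1 : Prod.mk b ⁻¹' (S ∩ Prod.fst ⁻¹' B) = Prod.mk b ⁻¹' S := by
        ext; simp [hb]
      rw [h1]
      simp [Set.indicator, hb]
    · have h1 : Prod.mk b ⁻¹' (S ∩ Prod.fst ⁻¹' B) = (∅ : Set γ) := by
        ext; simp [hb]
      rw [h1]
      simp [Set.indicator, hb]
  · exact (hg.ennreal_toReal.comp (comap_measurable Prod.fst)).aestronglyMeasurable

lemma condIndepRV_compProd {β α α' γ γ' : Type*} [MeasurableSpace β] [MeasurableSpace α]
    [MeasurableSpace α'] [MeasurableSpace γ] [MeasurableSpace γ']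
    (π : Measure β) [IsProbabilityMeasure π] (κ : Kernel β α) (κ' : Kernel β α')
    [IsMarkovKernel κ] [IsMarkovKernel κ'] {φ : β × α → γ} {ψ : β × α' → γ'}
    (hφ : Measurable φ) (hψ : Measurable ψ) :
    CondIndepRV (π ⊗ₘ (κ ×ₖ κ')) (MeasurableSpace.comap Prod.fst inferInstance)
      (fun w => φ (w.1, w.2.1)) (fun w => ψ (w.1, w.2.2)) := by
  intro A B hA hB
  have hφ' : Measurable fun w : β × α × α' => φ (w.1, w.2.1) := by fun_prop
  have hψ' : Measurable fun w : β × α × α' => ψ (w.1, w.2.2) := by fun_prop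
  filter_upwards [condExp_indicator_compProd π (κ ×ₖ κ') ((hφ' hA).inter (hψ' hB)),
    condExp_indicator_compProd π (κ ×ₖ κ') (hφ' hA),
    condExp_indicator_compProd π (κ ×ₖ κ') (hψ' hB)] with w h1 h2 h3
  rw [h1, h2, h3]
  have e1 : Prod.mk w.1 ⁻¹' (((fun w : β × α × α' => φ (w.1, w.2.1)) ⁻¹' A) ∩
      ((fun w => ψ (w.1, w.2.2)) ⁻¹' B)) =
      {x | φ (w.1, x) ∈ A} ×ˢ {y | ψ (w.1, y) ∈ B} := by
    ext; simp
  have e2 : Prod.mk w.1 ⁻¹' ((fun w : β × α × α' => φ (w.1, w.2.1)) ⁻¹' A) =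
      {x | φ (w.1, x) ∈ A} ×ˢ Set.univ := by
    ext; simp
  have e3 : Prod.mk w.1 ⁻¹' ((fun w : β × α × α' => ψ (w.1, w.2.2)) ⁻¹' B) =
      Set.univ ×ˢ {y | ψ (w.1, y) ∈ B} := by
    ext; simp
  rw [e1, e2, e3]
  simp [Kernel.prod_apply, Measure.prod_prod]

lemma exists_eq_smul_isProbabilityMeasure {γ : Type*} [MeasurableSpace γ] (z : γ) (m : Measure γ)
    [IsFiniteMeasure m] : ∃ m' : Measure γ, IsProbabilityMeasure m' ∧ m = m Set.univ • m' := by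
  by_cases hm : m = 0
  · exact ⟨Measure.dirac z, inferInstance, by simp [hm]⟩
  · have hm0 : m Set.univ ≠ 0 := by simpa using hm
    refine ⟨(m Set.univ)⁻¹ • m, ⟨?_⟩, ?_⟩
    · rw [Measure.smul_apply, smul_eq_mul, ENNReal.inv_mul_cancel hm0 (measure_ne_top _ _)]
    · rw [smul_smul, ENNReal.mul_inv_cancel hm0 (measure_ne_top _ _), one_smul]

/-- A mixture of products with finite entropy is the law of a pair which is conditionally
independent given a countably valued variable of finite entropy. -/
lemma IsProductMixture.exists_kernel {α β : Type*} [MeasurableSpace α] [MeasurableSpace β]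
    {Γ : Measure (α × β)} [IsProbabilityMeasure Γ] (h : IsProductMixture Γ) :
    ∃ (p : Measure ℕ) (κ : Kernel ℕ α) (κ' : Kernel ℕ β), IsProbabilityMeasure p ∧
      IsMarkovKernel κ ∧ IsMarkovKernel κ' ∧ p.bind (κ ×ₖ κ') = Γ ∧
      Summable fun n => Real.negMulLog (p {n}).toReal := by
  obtain ⟨μ, ν, hμ, hν, hΓ, hs⟩ := h
  obtain ⟨z⟩ := nonempty_of_isProbabilityMeasure Γ
  choose μ' hμ' hμμ' using fun v => exists_eq_smul_isProbabilityMeasure z.1 (μ v)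
  choose ν' hν' hνν' using fun v => exists_eq_smul_isProbabilityMeasure z.2 (ν v)
  let w : ℕ → ENNReal := fun v => μ v Set.univ * ν v Set.univ
  let p : Measure ℕ := Measure.sum fun v => w v • Measure.dirac v
  let κ : Kernel ℕ α := Kernel.ofFunOfCountable μ'
  let κ' : Kernel ℕ β := Kernel.ofFunOfCountable ν'
  have hκ : IsMarkovKernel κ := ⟨hμ'⟩
  have hκ' : IsMarkovKernel κ' := ⟨hν'⟩
  have hp : ∀ n, p {n} = w n := by
    intro n
    rw [Measure.sum_apply _ (measurableSet_singleton n), tsum_eq_single n]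
    · simp
    · intro m hm
      simp [hm]
  have hbind : p.bind (κ ×ₖ κ') = Γ := by
    ext S hS
    rw [Measure.bind_apply hS (Kernel.aemeasurable _), hΓ, Measure.sum_apply _ hS,
      lintegral_countable']
    refine tsum_congr fun v => ?_
    rw [hp, Kernel.prod_apply]
    change (μ' v).prod (ν' v) S * w v = _
    conv_rhs => rw [hμμ' v, hνν' v]
    rw [Measure.prod_smul_left, Measure.prod_smul_right, smul_smul, Measure.smul_apply,
      smul_eq_mul, mul_comm]
  refine ⟨p, κ, κ', ⟨?_⟩, hκ, hκ', hbind, by simpa only [hp] using hs⟩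
  have : p.bind (κ ×ₖ κ') Set.univ = 1 := by rw [hbind, measure_univ]
  rw [Measure.bind_apply MeasurableSet.univ (Kernel.aemeasurable _)] at this
  simpa using this

/-- Simulating `(X, Y)` from a common Gaussian part `θ` and a mixture of products. -/
lemma exists_simWitness {Ω : Type*} [MeasurableSpace Ω] {P : Measure Ω} {dX dY r : ℕ}
    {X : Ω → Fin dX → ℝ} {Y : Ω → Fin dY → ℝ} {Γ : Measure ((Fin dX → ℝ) × (Fin dY → ℝ))}
    [IsProbabilityMeasure Γ] (hΓ : IsProductMixture Γ) (τ : Measure (Fin r → ℝ))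
    [IsProbabilityMeasure τ] (NX : Matrix (Fin r) (Fin dX) ℝ) (L : Matrix (Fin dX) (Fin r) ℝ)
    (L' : Matrix (Fin dY) (Fin r) ℝ) (hL : NX * L = 1)
    (hlaw : (τ.prod Γ).map (fun z => (L *ᵥ z.1 + (z.2.1 - L *ᵥ (NX *ᵥ z.2.1)),
      L' *ᵥ z.1 + z.2.2)) = P.map fun ω => (X ω, Y ω)) :
    ∃ w : SimWitness P X Y r,
      ∀ ω, w.G.mulVec (Fin.append (w.X' ω) (w.Y' ω)) = NX.mulVec (w.X' ω) := by
  obtain ⟨p, κ, κ', hp, hκ, hκ', hbind, hs⟩ := hΓ.exists_kernel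
  let φ : (ℕ × (Fin r → ℝ)) × (Fin dX → ℝ) → Fin dX → ℝ :=
    fun z => L *ᵥ z.1.2 + (z.2 - L *ᵥ (NX *ᵥ z.2))
  let ψ : (ℕ × (Fin r → ℝ)) × (Fin dY → ℝ) → Fin dY → ℝ := fun z => L' *ᵥ z.1.2 + z.2
  have hmul : ∀ {m n : ℕ} (M : Matrix (Fin m) (Fin n) ℝ), Measurable fun v => M *ᵥ v :=
    fun M => (Continuous.matrix_mulVec continuous_const continuous_id).measurable
  have hφ : Measurable φ :=
    ((hmul L).comp (measurable_snd.comp measurable_fst)).add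
      (measurable_snd.sub ((hmul L).comp ((hmul NX).comp measurable_snd)))
  have hψ : Measurable ψ :=
    ((hmul L').comp (measurable_snd.comp measurable_fst)).add measurable_snd
  let η := Kernel.prodMkRight (Fin r → ℝ) κ
  let η' := Kernel.prodMkRight (Fin r → ℝ) κ'
  let Q := (p.prod τ) ⊗ₘ (η ×ₖ η')
  let G : Matrix (Fin r) (Fin (dX + dY)) ℝ := Matrix.of fun i => Fin.append (NX i) 0
  have hG : ∀ x y, G *ᵥ (Fin.append x y) = NX *ᵥ x := by
    intro x y
    ext i
    simp [Matrix.mulVec, dotProduct, Fin.sum_univ_add, G]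
  have hNX : ∀ z, NX *ᵥ (φ z) = z.1.2 := by
    intro z
    simp only [φ, Matrix.mulVec_add, Matrix.mulVec_sub, Matrix.mulVec_mulVec, hL]
    simp [← Matrix.mul_assoc, hL]
  have hfst : Q.map (fun w => (w.1.2, w.2)) = τ.prod Γ := by
    have hf : Measurable fun w : (ℕ × (Fin r → ℝ)) × (Fin dX → ℝ) × (Fin dY → ℝ) =>
        (w.1.2, w.2) := by fun_prop
    ext S hS
    have hmeas := (η ×ₖ η').measurable_kernel_prodMk_left (hf hS)
    rw [Measure.map_apply hf hS, Measure.compProd_apply (hf hS),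
      lintegral_prod_symm _ hmeas.aemeasurable, Measure.prod_apply hS]
    refine lintegral_congr fun θ => ?_
    rw [← hbind, Measure.bind_apply (measurable_prodMk_left hS) (Kernel.aemeasurable _)]
    refine lintegral_congr fun v => ?_
    rw [Kernel.prod_apply, Kernel.prod_apply]
    rfl
  have hV : ∀ n, Q ((fun w => w.1.1) ⁻¹' {n}) = p {n} := by
    intro n
    have h1 : (fun w : (ℕ × (Fin r → ℝ)) × (Fin dX → ℝ) × (Fin dY → ℝ) => w.1.1) ⁻¹' {n}
        = Prod.fst ⁻¹' (({n} : Set ℕ) ×ˢ (Set.univ : Set (Fin r → ℝ))) := by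
      ext; simp
    rw [h1, ← Measure.fst_apply ((measurableSet_singleton n).prod MeasurableSet.univ),
      Measure.fst_compProd, Measure.prod_prod, measure_univ, mul_one]
  have hmX : Measurable fun w : (ℕ × (Fin r → ℝ)) × (Fin dX → ℝ) × (Fin dY → ℝ) =>
      φ (w.1, w.2.1) := by fun_prop
  have hmY : Measurable fun w : (ℕ × (Fin r → ℝ)) × (Fin dX → ℝ) × (Fin dY → ℝ) =>
      ψ (w.1, w.2.2) := by fun_prop
  refine ⟨{ Ω' := (ℕ × (Fin r → ℝ)) × (Fin dX → ℝ) × (Fin dY → ℝ)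
            P' := Q
            probP' := inferInstance
            X' := fun w => φ (w.1, w.2.1)
            Y' := fun w => ψ (w.1, w.2.2)
            V := fun w => w.1.1
            G := G
            measX' := hmX
            measY' := hmY
            measV := by fun_prop
            sameLaw := ?_
            finEnt := ?_
            condIndep := ?_ }, fun ω => hG _ _⟩
  · rw [← hlaw, ← hfst, Measure.map_map ?_ (by fun_prop)]
    · rfl
    · exact ((hmul L).comp measurable_fst |>.add ((measurable_fst.comp measurable_snd).sub
        ((hmul L).comp ((hmul NX).comp (measurable_fst.comp measurable_snd))))).prodMk
        (((hmul L').comp measurable_fst).add (measurable_snd.comp measurable_snd))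
  · simpa only [HasFiniteEntropy, hV] using hs
  · simp only [hG, hNX]
    exact condIndepRV_compProd (p.prod τ) η η' hφ hψ

/-! ### Gram matrices and angles between subspaces -/

open scoped MatrixOrder in
lemma Matrix.PosSemidef.exists_gram {ι : Type*} [Fintype ι] [DecidableEq ι] {K : Matrix ι ι ℝ}
    (hK : K.PosSemidef) : ∃ z : ι → EuclideanSpace ℝ ι, K = Matrix.gram ℝ z := by
  obtain ⟨B, hB⟩ := CStarAlgebra.nonneg_iff_eq_star_mul_self.mp hK.nonneg
  refine ⟨fun i => WithLp.toLp 2 fun l => B l i, ?_⟩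
  rw [hB]
  ext i j
  simp [Matrix.mul_apply, Matrix.star_apply, PiLp.inner_apply, mul_comm]

lemma Matrix.rank_gram {ι H : Type*} [Fintype ι] [NormedAddCommGroup H]
    [InnerProductSpace ℝ H] [FiniteDimensional ℝ H] (z : ι → H) :
    (Matrix.gram ℝ z).rank = Module.finrank ℝ (Submodule.span ℝ (Set.range z)) := by
  let b := stdOrthonormalBasis ℝ H
  let e : H ≃ₗ[ℝ] (Fin (Module.finrank ℝ H) → ℝ) :=
    b.repr.toLinearEquiv.trans (WithLp.linearEquiv 2 ℝ _)
  rw [Matrix.gram_eq_conjTranspose_mul b z, Matrix.conjTranspose_eq_transpose_of_trivial,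
    Matrix.rank_transpose_mul_self, Matrix.rank_eq_finrank_span_cols,
    ← LinearEquiv.finrank_map_eq e, Submodule.map_span, ← Set.range_comp]
  rfl

lemma exists_abs_inner_le_of_disjoint {H : Type*} [NormedAddCommGroup H] [InnerProductSpace ℝ H]
    [FiniteDimensional ℝ H] {U W : Submodule ℝ H} (h : Disjoint U W) :
    ∃ ρ : ℝ, 0 < ρ ∧ ρ < 1 ∧ ∀ u ∈ U, ∀ w ∈ W, |inner ℝ u w| ≤ ρ * (‖u‖ * ‖w‖) := by
  let S : Set (H × H) := (Metric.sphere 0 1 ∩ U) ×ˢ (Metric.sphere 0 1 ∩ W)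
  have hS : IsCompact S :=
    ((isCompact_sphere 0 1).inter_right U.closed_of_finiteDimensional).prod
      ((isCompact_sphere 0 1).inter_right W.closed_of_finiteDimensional)
  have hlt : ∀ p ∈ S, |inner ℝ p.1 p.2| < 1 := by
    rintro ⟨u, w⟩ ⟨⟨hu, huU⟩, ⟨hw, hwW⟩⟩
    have hu1 : ‖u‖ = 1 := by simpa using hu
    have hw1 : ‖w‖ = 1 := by simpa using hw
    have hu0 : u ≠ 0 := by rintro rfl; simp at hu1
    have hw0 : w ≠ 0 := by rintro rfl; simp at hw1
    refine lt_of_le_of_ne (by simpa [hu1, hw1] using abs_real_inner_le_norm u w) fun heq => ?_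
    have h1 : |inner ℝ u w / (‖u‖ * ‖w‖)| = 1 := by simpa [hu1, hw1] using heq
    obtain ⟨-, c, hc, rfl⟩ := abs_real_inner_div_norm_mul_norm_eq_one_iff u w |>.mp h1
    have : u ∈ W := by
      have := W.smul_mem c⁻¹ hwW
      rwa [smul_smul, inv_mul_cancel₀ hc, one_smul] at this
    exact hu0 (Submodule.disjoint_def.mp h u huU this)
  obtain ⟨ρ, hρ0, hρ1, hρ⟩ : ∃ ρ : ℝ, 0 < ρ ∧ ρ < 1 ∧ ∀ p ∈ S, |inner ℝ p.1 p.2| ≤ ρ := by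
    rcases S.eq_empty_or_nonempty with hemp | hne
    · exact ⟨1 / 2, by norm_num, by norm_num, by simp [hemp]⟩
    · obtain ⟨p, hp, hmax⟩ := hS.exists_isMaxOn hne
        (f := fun p : H × H => |inner ℝ p.1 p.2|) (by fun_prop)
      exact ⟨max (1 / 2) |inner ℝ p.1 p.2|, by positivity, max_lt (by norm_num) (hlt p hp),
        fun q hq => (hmax hq).trans (le_max_right _ _)⟩
  refine ⟨ρ, hρ0, hρ1, fun u hu w hw => ?_⟩
  rcases eq_or_ne u 0 with rfl | hu0
  · simp
  rcases eq_or_ne w 0 with rfl | hw0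
  · simp
  have hun := norm_pos_iff.mpr hu0
  have hwn := norm_pos_iff.mpr hw0
  have := hρ (‖u‖⁻¹ • u, ‖w‖⁻¹ • w)
    ⟨⟨by simp [norm_smul, hun.ne'], U.smul_mem _ hu⟩,
      ⟨by simp [norm_smul, hwn.ne'], W.smul_mem _ hw⟩⟩
  rw [inner_smul_left, inner_smul_right, abs_mul, abs_mul] at this
  simp only [conj_trivial, abs_inv, abs_norm] at this
  rw [← mul_assoc, ← mul_inv, inv_mul_le_iff₀ (by positivity)] at this
  linarith

lemma sum_smul_mem_span_range {ι H : Type*} [Fintype ι] [AddCommGroup H] [Module ℝ H] (x : ι → H)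
    (a : ι → ℝ) : ∑ i, a i • x i ∈ Submodule.span ℝ (Set.range x) :=
  Submodule.sum_smul_mem _ a fun i _ => Submodule.subset_span (Set.mem_range_self i)

/-- Two families of vectors with trivially intersecting spans can be represented as the
coefficients of uncoupled pairs of equal correlation `ρ < 1`. -/
lemma exists_coeff_of_disjoint_span {ι κ H : Type*} [Fintype ι] [Fintype κ] [DecidableEq ι]
    [DecidableEq κ] [NormedAddCommGroup H] [InnerProductSpace ℝ H] [FiniteDimensional ℝ H]
    {x : ι → H} {y : κ → H}
    (h : Disjoint (Submodule.span ℝ (Set.range x)) (Submodule.span ℝ (Set.range y))) :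
    ∃ (ρ : ℝ) (c : ι ⊕ κ → ι → ℝ) (d : ι ⊕ κ → κ → ℝ), 0 < ρ ∧ ρ < 1 ∧
      ∀ (a : ι → ℝ) (b : κ → ℝ),
        ∑ l, (a ⬝ᵥ c l) ^ 2 = ‖∑ i, a i • x i‖ ^ 2 ∧ ∑ l, (b ⬝ᵥ d l) ^ 2 = ‖∑ j, b j • y j‖ ^ 2 ∧
        ρ * ∑ l, (a ⬝ᵥ c l) * (b ⬝ᵥ d l) = inner ℝ (∑ i, a i • x i) (∑ j, b j • y j) := by
  obtain ⟨ρ, hρ0, hρ1, hρ⟩ := exists_abs_inner_le_of_disjoint h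
  let M : Matrix (ι ⊕ κ) (ι ⊕ κ) ℝ := Matrix.fromBlocks (Matrix.gram ℝ x)
    (ρ⁻¹ • Matrix.of fun i j => inner ℝ (x i) (y j))
    (ρ⁻¹ • Matrix.of fun j i => inner ℝ (x i) (y j)) (Matrix.gram ℝ y)
  have hMH : M.IsHermitian := by
    ext i j
    rcases i with i | i <;> rcases j with j | j <;> simp [M, real_inner_comm]
  have hquad : ∀ a b a' b', Sum.elim a b ⬝ᵥ (M *ᵥ Sum.elim a' b') =
      inner ℝ (∑ i, a i • x i) (∑ i, a' i • x i) + ρ⁻¹ * inner ℝ (∑ i, a i • x i) (∑ j, b' j • y j)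
      + ρ⁻¹ * inner ℝ (∑ i, a' i • x i) (∑ j, b j • y j)
      + inner ℝ (∑ j, b j • y j) (∑ j, b' j • y j) := by
    intro a b a' b'
    have e1 := Matrix.star_dotProduct_gram_mulVec (𝕜 := ℝ) x a a'
    have e2 := Matrix.star_dotProduct_gram_mulVec (𝕜 := ℝ) y b b'
    rw [star_trivial] at e1 e2
    rw [Matrix.fromBlocks_mulVec, Sum.elim_comp_inl, Sum.elim_comp_inr,
      sumElim_dotProduct_sumElim, dotProduct_add, dotProduct_add, e1, e2]
    have e3 : ∀ (a : ι → ℝ) (b : κ → ℝ), a ⬝ᵥ ((Matrix.of fun i j => inner ℝ (x i) (y j)) *ᵥ b)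
        = inner ℝ (∑ i, a i • x i) (∑ j, b j • y j) := by
      intro a b
      simp only [dotProduct, Matrix.mulVec, sum_inner, inner_sum, inner_smul_left,
        inner_smul_right, Matrix.of_apply, Finset.mul_sum, conj_trivial]
      rw [Finset.sum_comm]
      exact Finset.sum_congr rfl fun j _ => Finset.sum_congr rfl fun i _ => by ring
    have e4 : b ⬝ᵥ ((Matrix.of fun j i => inner ℝ (x i) (y j)) *ᵥ a')
        = inner ℝ (∑ i, a' i • x i) (∑ j, b j • y j) := by
      rw [← e3, Matrix.dotProduct_mulVec, ← Matrix.mulVec_transpose, dotProduct_comm]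
      rfl
    rw [Matrix.smul_mulVec, Matrix.smul_mulVec, dotProduct_smul, dotProduct_smul, e3, e4]
    simp only [smul_eq_mul]
    ring
  have hM : M.PosSemidef := by
    refine .of_dotProduct_mulVec_nonneg hMH fun v => ?_
    obtain ⟨a, b, rfl⟩ : ∃ a b, v = Sum.elim a b := ⟨v ∘ Sum.inl, v ∘ Sum.inr, by simp⟩
    rw [star_trivial, hquad, real_inner_self_eq_norm_sq, real_inner_self_eq_norm_sq]
    have := neg_le_of_abs_le (hρ _ (sum_smul_mem_span_range x a) _ (sum_smul_mem_span_range y b))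
    set p := ‖∑ i, a i • x i‖
    set q := ‖∑ j, b j • y j‖
    set t : ℝ := inner ℝ (∑ i, a i • x i) (∑ j, b j • y j)
    have h2 : -(p * q) ≤ ρ⁻¹ * t := by
      have := mul_le_mul_of_nonneg_left this (inv_pos.mpr hρ0).le
      rwa [mul_neg, inv_mul_cancel_left₀ hρ0.ne'] at this
    nlinarith [sq_nonneg (p - q)]
  obtain ⟨w, hw⟩ := hM.exists_gram
  have hwq : ∀ a b a' b', ∑ l, (a ⬝ᵥ (fun i => w (Sum.inl i) l) + b ⬝ᵥ fun j => w (Sum.inr j) l) *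
      (a' ⬝ᵥ (fun i => w (Sum.inl i) l) + b' ⬝ᵥ fun j => w (Sum.inr j) l) =
      Sum.elim a b ⬝ᵥ (M *ᵥ Sum.elim a' b') := by
    intro a b a' b'
    have e := Matrix.star_dotProduct_gram_mulVec (𝕜 := ℝ) w (Sum.elim a b) (Sum.elim a' b')
    rw [hw, ← star_trivial (Sum.elim a b), e, PiLp.inner_apply]
    refine Finset.sum_congr rfl fun l _ => ?_
    simp [dotProduct, mul_comm]
  refine ⟨ρ, fun l i => w (Sum.inl i) l, fun l j => w (Sum.inr j) l, hρ0, hρ1, fun a b => ?_⟩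
  refine ⟨?_, ?_, ?_⟩
  · have := (hwq a 0 a 0).trans (hquad a 0 a 0)
    simpa [sq, real_inner_self_eq_norm_mul_norm] using this
  · have := (hwq 0 b 0 b).trans (hquad 0 b 0 b)
    simpa [sq, real_inner_self_eq_norm_mul_norm] using this
  · have := (hwq a 0 0 b).trans (hquad a 0 0 b)
    simp only [zero_dotProduct, add_zero, zero_add, Pi.zero_apply, zero_smul,
      Finset.sum_const_zero, inner_zero_left, inner_zero_right, mul_zero] at this
    rw [this, mul_inv_cancel_left₀ hρ0.ne']

lemma sum_vecMul_smul {σ H : Type*} {r : ℕ} [Fintype σ] [NormedAddCommGroup H]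
    [NormedSpace ℝ H] {f : Fin r → H} {T : H →L[ℝ] H} {M : Matrix σ (Fin r) ℝ} {v : σ → H}
    (h : ∀ i, ∑ k, M i k • f k = T (v i)) (a : σ → ℝ) :
    ∑ k, (a ᵥ* M) k • f k = T (∑ i, a i • v i) := by
  simp only [map_sum, map_smul, ← h, Finset.smul_sum, Matrix.vecMul, dotProduct,
    Finset.sum_smul, smul_smul]
  exact Finset.sum_comm

/-- Splitting two families of vectors along the intersection of their spans. -/
lemma exists_decomposition {ι κ H : Type*} {r : ℕ} [Fintype ι] [Fintype κ] [DecidableEq ι]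
    [DecidableEq κ] [NormedAddCommGroup H] [InnerProductSpace ℝ H] [FiniteDimensional ℝ H]
    {x : ι → H} {y : κ → H} {f : Fin r → H} {NX : Matrix (Fin r) ι ℝ}
    (hf : ∀ k, f k = ∑ i, NX k i • x i) (hli : LinearIndependent ℝ f)
    (hspan : Submodule.span ℝ (Set.range f) =
      Submodule.span ℝ (Set.range x) ⊓ Submodule.span ℝ (Set.range y)) :
    ∃ (ρ : ℝ) (c : ι ⊕ κ → ι → ℝ) (d : ι ⊕ κ → κ → ℝ) (L : Matrix ι (Fin r) ℝ)
      (L' : Matrix κ (Fin r) ℝ), 0 < ρ ∧ ρ < 1 ∧ NX * L = 1 ∧ (∀ l, NX *ᵥ c l = 0) ∧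
      ∀ (a : ι → ℝ) (b : κ → ℝ), ‖∑ k, ((a ᵥ* L) k + (b ᵥ* L') k) • f k‖ ^ 2
        + ∑ l, ((a ⬝ᵥ c l) ^ 2 + (b ⬝ᵥ d l) ^ 2 + 2 * ρ * ((a ⬝ᵥ c l) * (b ⬝ᵥ d l)))
        = ‖∑ i, a i • x i + ∑ j, b j • y j‖ ^ 2 := by
  set H0 := Submodule.span ℝ (Set.range f) with hH0
  have hproj : ∀ v, ∃ q : Fin r → ℝ, ∑ k, q k • f k = H0.starProjection v := fun v =>
    (Submodule.mem_span_range_iff_exists_fun ℝ).mp (H0.starProjection_apply_mem v)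
  choose L hL using fun i => hproj (x i)
  choose L' hL' using fun j => hproj (y j)
  let x1 : ι → H := fun i => x i - H0.starProjection (x i)
  let y1 : κ → H := fun j => y j - H0.starProjection (y j)
  have hx1 : ∀ a : ι → ℝ, ∑ i, a i • x1 i =
      ∑ i, a i • x i - H0.starProjection (∑ i, a i • x i) := by
    intro a
    simp [x1, smul_sub, Finset.sum_sub_distrib, map_sum]
  have hy1 : ∀ b : κ → ℝ, ∑ j, b j • y1 j =
      ∑ j, b j • y j - H0.starProjection (∑ j, b j • y j) := by
    intro b
    simp [y1, smul_sub, Finset.sum_sub_distrib, map_sum]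
  have hdisj : Disjoint (Submodule.span ℝ (Set.range x1)) (Submodule.span ℝ (Set.range y1)) := by
    rw [Submodule.disjoint_def]
    intro v hvx hvy
    obtain ⟨a, rfl⟩ := (Submodule.mem_span_range_iff_exists_fun ℝ).mp hvx
    obtain ⟨b, hb⟩ := (Submodule.mem_span_range_iff_exists_fun ℝ).mp hvy
    have h0 : ∀ v, H0.starProjection v ∈
        Submodule.span ℝ (Set.range x) ⊓ Submodule.span ℝ (Set.range y) := fun v =>
      hspan ▸ H0.starProjection_apply_mem v
    have h1 : ∑ i, a i • x1 i ∈ H0 := by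
      rw [hspan]
      refine ⟨?_, ?_⟩
      · rw [hx1]
        exact Submodule.sub_mem _ (sum_smul_mem_span_range x a) (h0 _).1
      · rw [← hb, hy1]
        exact Submodule.sub_mem _ (sum_smul_mem_span_range y b) (h0 _).2
    have h2 : ∑ i, a i • x1 i ∈ H0ᗮ := by
      rw [hx1]
      exact H0.sub_starProjection_mem_orthogonal _
    exact Submodule.disjoint_def.mp H0.orthogonal_disjoint _ h1 h2
  obtain ⟨ρ, c, d, hρ0, hρ1, hcd⟩ := exists_coeff_of_disjoint_span hdisj
  have hfH0 : ∀ k, H0.starProjection (f k) = f k := fun k =>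
    Submodule.starProjection_eq_self_iff.mpr (Submodule.subset_span (Set.mem_range_self k))
  refine ⟨ρ, c, d, L, L', hρ0, hρ1, ?_, fun l => ?_, fun a b => ?_⟩
  · ext k k'
    have h1 : ∑ m, ((NX k ᵥ* L) m - (1 : Matrix (Fin r) (Fin r) ℝ) k m) • f m = 0 := by
      simp only [sub_smul, Finset.sum_sub_distrib]
      rw [sum_vecMul_smul hL (NX k), ← hf, hfH0]
      simp [Matrix.one_apply]
    exact sub_eq_zero.mp (Fintype.linearIndependent_iff.mp hli _ h1 k')
  · ext k
    have h1 : ∑ i, NX k i • x1 i = 0 := by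
      rw [hx1, ← hf, hfH0, sub_self]
    have h2 := (hcd (NX k) 0).1
    rw [h1, norm_zero, zero_pow two_ne_zero] at h2
    exact pow_eq_zero_iff two_ne_zero |>.mp
      ((Finset.sum_eq_zero_iff_of_nonneg fun _ _ => sq_nonneg _).mp h2 l (Finset.mem_univ l))
  · obtain ⟨e1, e2, e3⟩ := hcd a b
    simp only [add_smul, Finset.sum_add_distrib, ← Finset.mul_sum, mul_assoc, e1, e2, e3]
    rw [sum_vecMul_smul hL a, sum_vecMul_smul hL' b, ← map_add,
      H0.norm_sq_eq_add_norm_sq_starProjection (∑ i, a i • x i + ∑ j, b j • y j),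
      Submodule.starProjection_orthogonal_val]
    have h1 : ∑ i, a i • x i + ∑ j, b j • y j -
        H0.starProjection (∑ i, a i • x i + ∑ j, b j • y j) =
        ∑ i, a i • x1 i + ∑ j, b j • y1 j := by
      rw [hx1, hy1, map_add]
      abel
    rw [h1, norm_add_sq_real]
    ring

/-! ### Attaining the dimension of the intersection -/

lemma StrongDual.apply_pi {ι : Type*} [Fintype ι] [DecidableEq ι] (Λ : StrongDual ℝ (ι → ℝ))
    (v : ι → ℝ) : Λ v = (fun i => Λ (Pi.single i 1)) ⬝ᵥ v := by
  conv_lhs => rw [pi_eq_sum_univ' v]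
  simp [dotProduct, mul_comm]

lemma StrongDual.apply_prod_pi {ι κ : Type*} [Fintype ι] [Fintype κ] [DecidableEq ι]
    [DecidableEq κ] (Λ : StrongDual ℝ ((ι → ℝ) × (κ → ℝ))) (v : ι → ℝ) (w : κ → ℝ) :
    Λ (v, w) = (fun i => Λ (Pi.single i 1, 0)) ⬝ᵥ v + (fun j => Λ (0, Pi.single j 1)) ⬝ᵥ w := by
  have h1 : (v, w) = ContinuousLinearMap.inl ℝ (ι → ℝ) (κ → ℝ) v +
      ContinuousLinearMap.inr ℝ (ι → ℝ) (κ → ℝ) w := by simp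
  rw [h1, map_add]
  exact congrArg₂ (· + ·)
    (StrongDual.apply_pi (Λ.comp (ContinuousLinearMap.inl ℝ (ι → ℝ) (κ → ℝ))) v)
    (StrongDual.apply_pi (Λ.comp (ContinuousLinearMap.inr ℝ (ι → ℝ) (κ → ℝ))) w)

lemma exists_simWitness_of_basis {Ω H : Type*} [MeasurableSpace Ω] {P : Measure Ω}
    [IsProbabilityMeasure P] {dX dY r : ℕ} {X : Ω → Fin dX → ℝ} {Y : Ω → Fin dY → ℝ}
    (hX : Measurable X) (hY : Measurable Y)
    [NormedAddCommGroup H] [InnerProductSpace ℝ H] [FiniteDimensional ℝ H]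
    {x : Fin dX → H} {y : Fin dY → H}
    (hlaw : ∀ Λ : StrongDual ℝ ((Fin dX → ℝ) × (Fin dY → ℝ)),
      charFunDual (P.map fun ω => (X ω, Y ω)) Λ = Complex.exp
        (-((‖∑ i, Λ (Pi.single i 1, 0) • x i + ∑ j, Λ (0, Pi.single j 1) • y j‖ ^ 2 : ℝ) : ℂ) / 2))
    {f : Fin r → H} {NX : Matrix (Fin r) (Fin dX) ℝ}
    (hf : ∀ k, f k = ∑ i, NX k i • x i) (hli : LinearIndependent ℝ f)
    (hspan : Submodule.span ℝ (Set.range f) =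
      Submodule.span ℝ (Set.range x) ⊓ Submodule.span ℝ (Set.range y)) :
    ∃ w : SimWitness P X Y r,
      ∀ ω, w.G.mulVec (Fin.append (w.X' ω) (w.Y' ω)) = NX.mulVec (w.X' ω) := by
  obtain ⟨ρ, c, d, L, L', hρ0, hρ1, hL, hc, hnorm⟩ := exists_decomposition hf hli hspan
  obtain ⟨Γ, hΓ, hmix, hΓchar⟩ := exists_isProductMixture_charFunDual hρ0 hρ1 c d Finset.univ
  have hpair : IsProbabilityMeasure (P.map fun ω => (X ω, Y ω)) :=
    Measure.isProbabilityMeasure_map (hX.prodMk hY).aemeasurable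
  let TN : (Fin dX → ℝ) →L[ℝ] (Fin r → ℝ) := (Matrix.mulVecLin NX).toContinuousLinearMap
  let TL : (Fin r → ℝ) →L[ℝ] (Fin dX → ℝ) := (Matrix.mulVecLin L).toContinuousLinearMap
  let TL' : (Fin r → ℝ) →L[ℝ] (Fin dY → ℝ) := (Matrix.mulVecLin L').toContinuousLinearMap
  let S : (Fin dX → ℝ) × (Fin dY → ℝ) →L[ℝ] (Fin r → ℝ) := TN.comp (ContinuousLinearMap.fst ℝ _ _)
  let τ := (P.map fun ω => (X ω, Y ω)).map S
  have hτ : IsProbabilityMeasure τ := Measure.isProbabilityMeasure_map (by fun_prop)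
  have hτchar : ∀ Λ : StrongDual ℝ (Fin r → ℝ), charFunDual τ Λ = Complex.exp
      (-((‖∑ k, Λ (Pi.single k 1) • f k‖ ^ 2 : ℝ) : ℂ) / 2) := by
    intro Λ
    rw [charFunDual_map, hlaw]
    have h1 : ∀ i, Λ.comp S (Pi.single i 1, 0) = ∑ k, NX k i * Λ (Pi.single k 1) := by
      intro i
      have : Λ.comp S (Pi.single i 1, 0) = Λ (NX *ᵥ Pi.single i 1) := rfl
      rw [this, Λ.apply_pi, Matrix.mulVec_single_one]
      simp [dotProduct, mul_comm]
    have h2 : ∀ j, Λ.comp S (0, Pi.single j 1) = 0 := by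
      intro j
      simp [S]
    have h3 : ∑ i, Λ.comp S (Pi.single i 1, 0) • x i + ∑ j, Λ.comp S (0, Pi.single j 1) • y j
        = ∑ k, Λ (Pi.single k 1) • f k := by
      simp only [h1, h2, hf, zero_smul, Finset.sum_const_zero, add_zero, Finset.sum_smul,
        Finset.smul_sum, smul_smul]
      rw [Finset.sum_comm]
      simp only [mul_comm]
    rw [h3]
  let T : (Fin r → ℝ) × ((Fin dX → ℝ) × (Fin dY → ℝ)) →L[ℝ] (Fin dX → ℝ) × (Fin dY → ℝ) :=
    (TL.comp (ContinuousLinearMap.fst ℝ _ _) +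
      (ContinuousLinearMap.id ℝ _ - TL.comp TN).comp
        ((ContinuousLinearMap.fst ℝ _ _).comp (ContinuousLinearMap.snd ℝ _ _))).prod
    (TL'.comp (ContinuousLinearMap.fst ℝ _ _) +
      (ContinuousLinearMap.snd ℝ _ _).comp (ContinuousLinearMap.snd ℝ _ _))
  have hT : (fun z : (Fin r → ℝ) × ((Fin dX → ℝ) × (Fin dY → ℝ)) =>
      (L *ᵥ z.1 + (z.2.1 - L *ᵥ (NX *ᵥ z.2.1)), L' *ᵥ z.1 + z.2.2)) = T := by
    funext z
    simp [T, TL, TN, TL']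
  refine exists_simWitness hmix τ NX L L' hL ?_
  have := Measure.isProbabilityMeasure_map (μ := τ.prod Γ) (f := T) (by fun_prop)
  rw [hT]
  refine Measure.ext_of_charFunDual ?_
  funext Λ
  rw [charFunDual_map, charFunDual_prod, hτchar, hΓchar, hlaw, ← hnorm, ← Complex.exp_add]
  congr 1
  have h1 : ∀ k, (Λ.comp T).comp (ContinuousLinearMap.inl ℝ _ _) (Pi.single k 1) =
      ((fun i => Λ (Pi.single i 1, 0)) ᵥ* L) k + ((fun j => Λ (0, Pi.single j 1)) ᵥ* L') k := by
    intro k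
    have : T (Pi.single k 1, 0) = (L *ᵥ Pi.single k 1, L' *ᵥ Pi.single k 1) := by
      simp [T, TL, TL']
    rw [ContinuousLinearMap.comp_apply, ContinuousLinearMap.comp_apply,
      ContinuousLinearMap.inl_apply, this, StrongDual.apply_prod_pi, Matrix.dotProduct_mulVec,
      Matrix.dotProduct_mulVec, dotProduct_single_one, dotProduct_single_one]
  have h2 : ∀ l, (Λ.comp T).comp (ContinuousLinearMap.inr ℝ _ _) (c l, 0) =
      (fun i => Λ (Pi.single i 1, 0)) ⬝ᵥ c l := by
    intro l
    have : T (0, (c l, 0)) = (c l, 0) := by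
      simp [T, TL, TN, hc]
    rw [ContinuousLinearMap.comp_apply, ContinuousLinearMap.comp_apply,
      ContinuousLinearMap.inr_apply, this, StrongDual.apply_prod_pi, dotProduct_zero, add_zero]
  have h3 : ∀ l, (Λ.comp T).comp (ContinuousLinearMap.inr ℝ _ _) (0, d l) =
      (fun j => Λ (0, Pi.single j 1)) ⬝ᵥ d l := by
    intro l
    have : T (0, (0, d l)) = (0, d l) := by
      simp [T, TL, TN]
    rw [ContinuousLinearMap.comp_apply, ContinuousLinearMap.comp_apply,
      ContinuousLinearMap.inr_apply, this, StrongDual.apply_prod_pi, dotProduct_zero, zero_add]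
  simp only [h1, h2, h3]
  push_cast
  ring
/-! ### Linear functionals of a centred Gaussian vector -/

section GaussianVec

variable {Ω ι : Type*} [MeasurableSpace Ω] {P : Measure Ω} [Fintype ι]
  {Z : Ω → ι → ℝ}

lemma IsGaussianVec.memLp_two (hZ : IsGaussianVec P Z) (i : ι) :
    MemLp (fun ω => Z ω i) 2 P := by
  classical
  obtain ⟨m, v, h⟩ := hZ (Pi.single i 1)
  have h1 : (fun ω => ∑ j, (Pi.single i 1 : ι → ℝ) j * Z ω j) = fun ω => Z ω i := by
    funext ω
    exact single_one_dotProduct i (Z ω)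
  rw [h1] at h
  have : HasGaussianLaw (fun ω => Z ω i) P := ⟨h ▸ inferInstance⟩
  exact this.memLp_two

lemma IsGaussianVec.integral_sq (hZ : IsGaussianVec P Z)
    {K : Matrix ι ι ℝ} (hK : ∀ i j, K i j = ∫ ω, Z ω i * Z ω j ∂P) (a : ι → ℝ) :
    ∫ ω, (∑ i, a i * Z ω i) ^ 2 ∂P = a ⬝ᵥ (K *ᵥ a) := by
  have hint : ∀ i j, Integrable (fun ω => a i * Z ω i * (a j * Z ω j)) P := fun i j =>
    ((hZ.memLp_two i).const_mul (a i)).integrable_mul ((hZ.memLp_two j).const_mul (a j))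
  simp_rw [sq, Finset.sum_mul_sum]
  rw [integral_finsetSum _ fun i _ => integrable_finsetSum _ fun j _ => hint i j]
  simp_rw [fun i => integral_finsetSum Finset.univ fun j _ => hint i j, dotProduct, mulVec,
    dotProduct, Finset.mul_sum, hK, ← integral_mul_const, ← integral_const_mul]
  refine Finset.sum_congr rfl fun i _ => Finset.sum_congr rfl fun j _ =>
    integral_congr_ae (.of_forall fun ω => ?_)
  simp only
  ring

lemma IsGaussianVec.posSemidef (hZ : IsGaussianVec P Z)
    {K : Matrix ι ι ℝ} (hK : ∀ i j, K i j = ∫ ω, Z ω i * Z ω j ∂P) : K.PosSemidef := by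
  refine .of_dotProduct_mulVec_nonneg ?_ fun a => ?_
  · ext i j
    simp [hK, mul_comm]
  · rw [star_trivial, ← hZ.integral_sq hK]
    positivity

lemma IsGaussianVec.map_eq [IsFiniteMeasure P] (hZ : IsGaussianVec P Z) (hmeas : Measurable Z)
    (hm : ∀ i, ∫ ω, Z ω i ∂P = 0)
    {K : Matrix ι ι ℝ} (hK : ∀ i j, K i j = ∫ ω, Z ω i * Z ω j ∂P) (a : ι → ℝ) :
    P.map (fun ω => ∑ i, a i * Z ω i) = gaussianReal 0 (a ⬝ᵥ (K *ᵥ a)).toNNReal := by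
  obtain ⟨m, v, h⟩ := hZ a
  have hW : Measurable fun ω => ∑ i, a i * Z ω i := by fun_prop
  have h1 : m = 0 := by
    rw [← integral_id_gaussianReal (μ := m) (v := v), ← h,
      integral_map hW.aemeasurable (by fun_prop),
      integral_finsetSum _ fun i _ => ((hZ.memLp_two i).const_mul (a i)).integrable (by simp)]
    simp [integral_const_mul, hm]
  subst h1
  have h2 : (v : ℝ) = a ⬝ᵥ (K *ᵥ a) := by
    rw [← hZ.integral_sq hK, ← variance_id_gaussianReal (μ := 0) (v := v),
      variance_of_integral_eq_zero (by fun_prop)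
        (by simp [integral_id_gaussianReal]), ← h,
      integral_map hW.aemeasurable (by fun_prop)]
    rfl
  rw [h, ← h2, Real.toNNReal_coe]

lemma IsGaussianVec.exists_gram [IsFiniteMeasure P] [DecidableEq ι]
    (hZ : IsGaussianVec P Z) (hmeas : Measurable Z)
    (hm : ∀ i, ∫ ω, Z ω i ∂P = 0)
    {K : Matrix ι ι ℝ} (hK : ∀ i j, K i j = ∫ ω, Z ω i * Z ω j ∂P) :
    ∃ z : ι → EuclideanSpace ℝ ι, K = Matrix.gram ℝ z ∧
      ∀ a : ι → ℝ, P.map (fun ω => ∑ i, a i * Z ω i) =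
        gaussianReal 0 (‖∑ i, a i • z i‖ ^ 2).toNNReal := by
  obtain ⟨z, hz⟩ := (hZ.posSemidef hK).exists_gram
  refine ⟨z, hz, fun a => ?_⟩
  have h1 := Matrix.star_dotProduct_gram_mulVec (𝕜 := ℝ) z a a
  rw [star_trivial, real_inner_self_eq_norm_sq] at h1
  rw [hZ.map_eq hmeas hm hK, hz, h1]

end GaussianVec

lemma charFunDual_map_prodMk {Ω H : Type*} [MeasurableSpace Ω] {P : Measure Ω}
    {dX dY : ℕ} {X : Ω → Fin dX → ℝ} {Y : Ω → Fin dY → ℝ}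
    (hX : Measurable X) (hY : Measurable Y) [NormedAddCommGroup H] [InnerProductSpace ℝ H]
    {z : Fin (dX + dY) → H}
    (hz : ∀ a : Fin (dX + dY) → ℝ, P.map (fun ω => ∑ i, a i * Fin.append (X ω) (Y ω) i) =
        gaussianReal 0 (‖∑ i, a i • z i‖ ^ 2).toNNReal)
    (Λ : StrongDual ℝ ((Fin dX → ℝ) × (Fin dY → ℝ))) :
    charFunDual (P.map fun ω => (X ω, Y ω)) Λ = Complex.exp
        (-((‖∑ i, Λ (Pi.single i 1, 0) • z (Fin.castAdd dY i) +
          ∑ j, Λ (0, Pi.single j 1) • z (Fin.natAdd dX j)‖ ^ 2 : ℝ) : ℂ) / 2) := by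
  have h := hz (Fin.append (fun i => Λ (Pi.single i 1, 0)) fun j => Λ (0, Pi.single j 1))
  simp only [Fin.sum_univ_add, Fin.append_left, Fin.append_right] at h
  have h1 : (fun ω => ∑ i, Λ (Pi.single i 1, 0) * X ω i + ∑ j, Λ (0, Pi.single j 1) * Y ω j) =
      Λ ∘ fun ω => (X ω, Y ω) := by
    funext ω
    exact (Λ.apply_prod_pi (X ω) (Y ω)).symm
  rw [h1, ← Measure.map_map (by fun_prop) (by fun_prop)] at h
  rw [charFunDual_eq_charFun_map_one, h, charFun_gaussianReal, Real.coe_toNNReal _ (by positivity)]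
  simp [neg_div]
/-! ### The lower bound -/

lemma Matrix.measurable_mulVec {ι κ : Type*} [Fintype ι] (M : Matrix κ ι ℝ) :
    Measurable fun v : ι → ℝ => M *ᵥ v :=
  measurable_pi_lambda _ fun l => by simp only [mulVec, dotProduct]; fun_prop

lemma Measurable.fin_append {Ω : Type*} [MeasurableSpace Ω] {m n : ℕ} {X : Ω → Fin m → ℝ}
    {Y : Ω → Fin n → ℝ} (hX : Measurable X) (hY : Measurable Y) :
    Measurable fun ω => Fin.append (X ω) (Y ω) := by
  refine measurable_pi_lambda _ (Fin.addCases (fun i => ?_) fun j => ?_)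
  · simp only [Fin.append_left]
    fun_prop
  · simp only [Fin.append_right]
    fun_prop

lemma indepFun_of_inner_eq_zero {Ω ι H : Type*} {k : ℕ} [MeasurableSpace Ω] {P : Measure Ω}
    [IsFiniteMeasure P] [Fintype ι] {Z : Ω → ι → ℝ} (hmeas : Measurable Z)
    [NormedAddCommGroup H] [InnerProductSpace ℝ H] {z : ι → H}
    (hz : ∀ a : ι → ℝ, P.map (fun ω => ∑ i, a i * Z ω i) =
        gaussianReal 0 (‖∑ i, a i • z i‖ ^ 2).toNNReal)
    {c : ι → ℝ} {G : Matrix (Fin k) ι ℝ}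
    (h : ∀ l, inner ℝ (∑ i, c i • z i) (∑ i, G l i • z i) = 0) :
    IndepFun (fun ω => ∑ i, c i * Z ω i) (fun ω => G *ᵥ Z ω) P := by
  have hc : Measurable fun ω => ∑ i, c i * Z ω i := by fun_prop
  have hG : Measurable fun ω => G *ᵥ Z ω := G.measurable_mulVec.comp hmeas
  have hchar : ∀ a : ι → ℝ, charFun (P.map fun ω => ∑ i, a i * Z ω i) 1 =
      Complex.exp (-((‖∑ i, a i • z i‖ ^ 2 : ℝ) : ℂ) / 2) := fun a => by
    rw [hz, charFun_gaussianReal, Real.coe_toNNReal _ (by positivity)]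
    simp [neg_div]
  rw [indepFun_iff_charFunDual_prod hc.aemeasurable hG.aemeasurable]
  intro Λ
  obtain ⟨α, hα⟩ : ∃ α, α = Λ (1, 0) := ⟨_, rfl⟩
  obtain ⟨μ, hμ⟩ : ∃ μ : Fin k → ℝ, μ = fun l => Λ (0, Pi.single l 1) := ⟨_, rfl⟩
  have hl : ∀ t : ℝ, Λ (t, 0) = α * t := fun t => by
    rw [show ((t, 0) : ℝ × (Fin k → ℝ)) = t • (1, 0) by simp, map_smul, hα, smul_eq_mul, mul_comm]
  have hr : ∀ v : Fin k → ℝ, Λ (0, v) = μ ⬝ᵥ v := fun v => by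
    rw [hμ]
    exact StrongDual.apply_pi (Λ.comp (.inr ℝ ℝ (Fin k → ℝ))) v
  have hlr : ∀ (t : ℝ) (v : Fin k → ℝ), Λ (t, v) = α * t + μ ⬝ᵥ v := fun t v => by
    rw [← hl, ← hr, ← map_add]
    simp
  have e1 : (Λ ∘ fun ω => (∑ i, c i * Z ω i, G *ᵥ Z ω)) =
      fun ω => ∑ i, (α * c i + (μ ᵥ* G) i) * Z ω i := by
    funext ω
    simp only [Function.comp, hlr, Matrix.dotProduct_mulVec, add_mul, Finset.sum_add_distrib,
      Finset.mul_sum, mul_assoc]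
    rfl
  have e2 : (Λ.comp (.inl ℝ ℝ (Fin k → ℝ)) ∘ fun ω => ∑ i, c i * Z ω i) =
      fun ω => ∑ i, (α * c i) * Z ω i := by
    funext ω
    simp only [Function.comp, ContinuousLinearMap.comp_apply, ContinuousLinearMap.inl_apply, hl,
      Finset.mul_sum, mul_assoc]
  have e3 : (Λ.comp (.inr ℝ ℝ (Fin k → ℝ)) ∘ fun ω => G *ᵥ Z ω) =
      fun ω => ∑ i, (μ ᵥ* G) i * Z ω i := by
    funext ω
    simp only [Function.comp, ContinuousLinearMap.comp_apply, ContinuousLinearMap.inr_apply, hr,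
      Matrix.dotProduct_mulVec]
    rfl
  rw [charFunDual_eq_charFun_map_one, charFunDual_eq_charFun_map_one,
    charFunDual_eq_charFun_map_one, Measure.map_map (by fun_prop) (by fun_prop),
    Measure.map_map (by fun_prop) hc, Measure.map_map (by fun_prop) hG, e1, e2, e3, hchar, hchar,
    hchar, ← Complex.exp_add]
  congr 1
  have horth : inner ℝ (∑ i, (α * c i) • z i) (∑ i, (μ ᵥ* G) i • z i) = 0 := by
    have e : ∑ i, (μ ᵥ* G) i • z i = ∑ l, μ l • ∑ i, G l i • z i := by
      simp only [vecMul, dotProduct, Finset.sum_smul, Finset.smul_sum, smul_smul]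
      exact Finset.sum_comm
    simp only [e, mul_smul, ← Finset.smul_sum]
    rw [inner_sum]
    exact Finset.sum_eq_zero fun l _ => by simp [inner_smul_left, inner_smul_right, h]
  simp only [add_smul, Finset.sum_add_distrib]
  rw [sq, norm_add_sq_eq_norm_sq_add_norm_sq_of_inner_eq_zero _ _ horth]
  push_cast
  ring

lemma CondIndepRV.exists_measurableSet_ae_iff {Ω α β S : Type*} [MeasurableSpace Ω]
    [MeasurableSpace α] [MeasurableSpace β] [MeasurableSpace S] {P : Measure Ω} [IsFiniteMeasure P]
    {F : Ω → S} {X : Ω → α} {Y : Ω → β} (h : CondIndepRV P (.comap F inferInstance) X Y)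
    (hF : Measurable F) (hX : Measurable X) {A : Set α} {B : Set β} (hA : MeasurableSet A)
    (hB : MeasurableSet B) (hAB : ∀ᵐ ω ∂P, X ω ∈ A ↔ Y ω ∈ B) :
    ∃ s : Set S, MeasurableSet s ∧ ∀ᵐ ω ∂P, X ω ∈ A ↔ F ω ∈ s := by
  set m : MeasurableSpace Ω := .comap F inferInstance with hm
  have hle : m ≤ _ := hF.comap_le
  set p := P[(X ⁻¹' A).indicator (fun _ => (1 : ℝ)) | m] with hp
  have hpm : StronglyMeasurable[m] p := stronglyMeasurable_condExp
  have hint : Integrable ((X ⁻¹' A).indicator (fun _ => (1 : ℝ))) P :=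
    (integrable_const 1).indicator (hX hA)
  have h1 : ((X ⁻¹' A) ∩ (Y ⁻¹' B)).indicator (fun _ => (1 : ℝ)) =ᵐ[P]
      (X ⁻¹' A).indicator fun _ => (1 : ℝ) := by
    filter_upwards [hAB] with ω hω
    by_cases hωA : X ω ∈ A
    · simp [hωA, hω.1 hωA]
    · simp [hωA]
  have h2 : (Y ⁻¹' B).indicator (fun _ => (1 : ℝ)) =ᵐ[P]
      (X ⁻¹' A).indicator fun _ => (1 : ℝ) := by
    filter_upwards [hAB] with ω hω
    by_cases hωA : X ω ∈ A
    · simp [hωA, hω.1 hωA]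
    · simp [hωA, mt hω.2 hωA]
  have hsq : ∀ᵐ ω ∂P, p ω = p ω * p ω := by
    filter_upwards [h A B hA hB, condExp_congr_ae (m := m) h1, condExp_congr_ae (m := m) h2]
      with ω e0 e1 e2
    rw [e1, e2] at e0
    exact e0
  have hset : ∀ s, MeasurableSet[m] s →
      ∫ ω in s, p ω ∂P = P.real ((X ⁻¹' A) ∩ s) := fun s hs => by
    rw [setIntegral_condExp hle hint hs, integral_indicator_const _ (hX hA)]
    simp [measureReal_restrict_apply (hX hA)]
  have hmeas0 : MeasurableSet[m] (p ⁻¹' {0}) := hpm.measurable (measurableSet_singleton 0)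
  have hmeas1 : MeasurableSet[m] (p ⁻¹' {1}) := hpm.measurable (measurableSet_singleton 1)
  have hzero : P ((X ⁻¹' A) ∩ p ⁻¹' {0}) = 0 := by
    rw [← measureReal_eq_zero_iff, ← hset _ hmeas0]
    exact setIntegral_eq_zero_of_forall_eq_zero fun ω hω => hω
  have hone : P (p ⁻¹' {1} \ (X ⁻¹' A)) = 0 := by
    rw [← measureReal_eq_zero_iff]
    have e1 := hset _ hmeas1
    rw [setIntegral_congr_fun (hle _ hmeas1) (g := fun _ => (1 : ℝ)) fun ω hω => hω] at e1
    have e2 := measureReal_inter_add_sdiff (μ := P) (s := p ⁻¹' {1}) (hX hA)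
    rw [Set.inter_comm, ← e1] at e2
    simpa using e2
  obtain ⟨s, hs, hps⟩ := hmeas1
  refine ⟨s, hs, ?_⟩
  filter_upwards [hsq, measure_eq_zero_iff_ae_notMem.1 hzero, measure_eq_zero_iff_ae_notMem.1 hone]
    with ω e0 e1 e2
  rw [← Set.mem_preimage (f := F), hps]
  refine ⟨fun hω => ?_, fun hω => ?_⟩
  · rcases mul_eq_zero.1 (show p ω * (p ω - 1) = 0 by linarith) with e | e
    · exact absurd ⟨hω, e⟩ e1
    · exact sub_eq_zero.1 e
  · by_contra hn
    exact e2 ⟨hω, hn⟩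

lemma CondIndepRV.exists_measurable_ae_eq {Ω α β S : Type*} [MeasurableSpace Ω]
    [MeasurableSpace α] [MeasurableSpace β] [MeasurableSpace S] {P : Measure Ω} [IsFiniteMeasure P]
    {F : Ω → S} {X : Ω → α} {Y : Ω → β} (h : CondIndepRV P (.comap F inferInstance) X Y)
    (hF : Measurable F) (hX : Measurable X) {f : α → ℝ} {g : β → ℝ} (hf : Measurable f)
    (hg : Measurable g) (hfg : ∀ᵐ ω ∂P, f (X ω) = g (Y ω)) :
    ∃ φ : S → EReal, Measurable φ ∧ ∀ᵐ ω ∂P, (f (X ω) : EReal) = φ (F ω) := by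
  classical
  have key := fun q : ℚ => h.exists_measurableSet_ae_iff hF hX (A := f ⁻¹' Set.Iic q)
    (B := g ⁻¹' Set.Iic q) (hf measurableSet_Iic) (hg measurableSet_Iic) (by
      filter_upwards [hfg] with ω hω
      simp [hω])
  choose s hs hsω using key
  refine ⟨fun u => ⨅ q : ℚ, if u ∈ s q then ((q : ℝ) : EReal) else ⊤,
    .iInf fun q => Measurable.ite (hs q) measurable_const measurable_const, ?_⟩
  filter_upwards [ae_all_iff.2 hsω] with ω hω
  refine le_antisymm (le_iInf fun q => ?_) (le_of_forall_gt fun b hb => ?_)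
  · split_ifs with hq
    · exact EReal.coe_le_coe ((hω q).2 hq)
    · exact le_top
  · obtain ⟨q, hq1, hq2⟩ := EReal.exists_rat_btwn_of_lt hb
    refine lt_of_le_of_lt (iInf_le _ q) ?_
    rw [if_pos ((hω q).1 (EReal.coe_lt_coe_iff.1 hq1).le)]
    exact hq2

lemma ProbabilityTheory.IndepFun.not_ae_eq_of_nullSingletonClass {Ω E : Type*}
    [MeasurableSpace Ω] [MeasurableSpace E]
    {P : Measure Ω} [IsProbabilityMeasure P] {T : Ω → ℝ} {g : Ω → E} {V : Ω → ℕ}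
    (h : IndepFun T g P) (hT : Measurable T) (hg : Measurable g)
    (hatom : NullSingletonClass (P.map T))
    {φ : ℕ × E → EReal} (hφ : Measurable φ) : ¬ ∀ᵐ ω ∂P, (T ω : EReal) = φ (V ω, g ω) := by
  intro hae
  have hn : ∀ n, ∀ᵐ ω ∂P, (T ω : EReal) ≠ φ (n, g ω) := fun n => by
    have hs : MeasurableSet {x : ℝ × E | (x.1 : EReal) ≠ φ (n, x.2)} :=
      (measurableSet_eq_fun (by fun_prop) (by fun_prop)).compl
    have hprod : ∀ᵐ x ∂(P.map T).prod (P.map g), (x.1 : EReal) ≠ φ (n, x.2) := by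
      have := Measure.isProbabilityMeasure_map (μ := P) hT.aemeasurable
      have := Measure.isProbabilityMeasure_map (μ := P) hg.aemeasurable
      rw [← Measure.prod_swap, ae_map_iff (by fun_prop) hs]
      refine (Measure.ae_prod_iff_ae_ae (measurable_swap hs)).2 (.of_forall fun y => ?_)
      refine measure_mono_null (fun t ht => ?_)
        (Set.Subsingleton.measure_zero (s := {t : ℝ | (t : EReal) = φ (n, y)}) ?_ _)
      · simpa using ht
      · intro a ha b hb
        exact EReal.coe_injective (ha.trans hb.symm)
    rw [← (indepFun_iff_map_prod_eq_prod_map_map hT.aemeasurable hg.aemeasurable).1 h,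
      ae_map_iff (by fun_prop) hs] at hprod
    exact hprod
  obtain ⟨ω, hω, hω'⟩ := (hae.and (ae_all_iff.2 hn)).exists
  exact hω' _ hω

lemma exists_mem_ne_zero_inner_eq_zero {H : Type*} [NormedAddCommGroup H] [InnerProductSpace ℝ H]
    {W : Submodule ℝ H} [FiniteDimensional ℝ W] {k : ℕ} (hk : k < Module.finrank ℝ W)
    (g : Fin k → H) : ∃ f ∈ W, f ≠ 0 ∧ ∀ l, inner ℝ f (g l) = 0 := by
  let T : W →ₗ[ℝ] Fin k → ℝ := LinearMap.pi fun l => (innerₗ H (g l)).comp W.subtype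
  have hT : T.ker ≠ ⊥ := LinearMap.ker_ne_bot_of_finrank_lt (by simpa using hk)
  obtain ⟨f, hf, hf0⟩ := Submodule.exists_mem_ne_zero_of_ne_bot hT
  refine ⟨f, f.2, by simpa using hf0, fun l => ?_⟩
  rw [real_inner_comm]
  exact congrFun (LinearMap.mem_ker.1 hf) l

lemma SimWitness.finrank_le {Ω H : Type*} [MeasurableSpace Ω] {P : Measure Ω}
    {dX dY k : ℕ} {X : Ω → Fin dX → ℝ} {Y : Ω → Fin dY → ℝ} (w : SimWitness P X Y k)
    (hX : Measurable X) (hY : Measurable Y) [NormedAddCommGroup H] [InnerProductSpace ℝ H]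
    {z : Fin (dX + dY) → H}
    (hz : ∀ a : Fin (dX + dY) → ℝ, P.map (fun ω => ∑ i, a i * Fin.append (X ω) (Y ω) i) =
        gaussianReal 0 (‖∑ i, a i • z i‖ ^ 2).toNNReal) :
    Module.finrank ℝ ↑(Submodule.span ℝ (Set.range fun i => z (Fin.castAdd dY i)) ⊓
      Submodule.span ℝ (Set.range fun j => z (Fin.natAdd dX j))) ≤ k := by
  by_contra! hk
  have : FiniteDimensional ℝ (Submodule.span ℝ (Set.range fun i => z (Fin.castAdd dY i))) :=
    .span_of_finite ℝ (Set.finite_range _)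
  obtain ⟨f, ⟨hfx, hfy⟩, hf0, hforth⟩ := exists_mem_ne_zero_inner_eq_zero hk
    fun l => ∑ i, w.G l i • z i
  obtain ⟨a, ha⟩ := Submodule.mem_span_range_iff_exists_fun ℝ |>.1 hfx
  obtain ⟨b, hb⟩ := Submodule.mem_span_range_iff_exists_fun ℝ |>.1 hfy
  let _ := w.mΩ'
  have := w.probP'
  have hX' := w.measX'
  have hY' := w.measY'
  have hZ' : Measurable fun ω => Fin.append (w.X' ω) (w.Y' ω) := hX'.fin_append hY'
  have hGZ : Measurable fun ω => w.G *ᵥ Fin.append (w.X' ω) (w.Y' ω) :=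
    w.G.measurable_mulVec.comp hZ'
  have hz' : ∀ c : Fin (dX + dY) → ℝ,
      w.P'.map (fun ω => ∑ i, c i * Fin.append (w.X' ω) (w.Y' ω) i) =
        gaussianReal 0 (‖∑ i, c i • z i‖ ^ 2).toNNReal := fun c => by
    have hc : Measurable fun u : (Fin dX → ℝ) × (Fin dY → ℝ) =>
        ∑ i, c i * Fin.append u.1 u.2 i := by
      have := measurable_fst.fin_append
        (measurable_snd : Measurable (Prod.snd : (Fin dX → ℝ) × (Fin dY → ℝ) → _))
      fun_prop
    rw [← hz c]
    have := congrArg (Measure.map fun u : (Fin dX → ℝ) × (Fin dY → ℝ) =>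
        ∑ i, c i * Fin.append u.1 u.2 i) w.sameLaw
    rwa [Measure.map_map hc (by fun_prop), Measure.map_map hc (by fun_prop)] at this
  have hTeq : ∀ᵐ ω ∂w.P', ∑ i, a i * w.X' ω i = ∑ j, b j * w.Y' ω j := by
    have h := hz' (Fin.append a (-b))
    simp only [Fin.sum_univ_add, Fin.append_left, Fin.append_right, Pi.neg_apply, neg_smul,
      Finset.sum_neg_distrib, ha, hb, neg_mul] at h
    have h0 : ∀ᵐ t ∂gaussianReal 0 (‖f + -f‖ ^ 2).toNNReal, t = 0 := by
      simp [gaussianReal_zero_var, ae_dirac_eq]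
    rw [← h] at h0
    filter_upwards [ae_of_ae_map (by fun_prop) h0] with ω hω
    linarith
  obtain ⟨φ, hφ, hTφ⟩ := w.condIndep.exists_measurable_ae_eq
    (w.measV.prodMk hGZ) hX' (f := fun v => ∑ i, a i * v i) (g := fun v => ∑ j, b j * v j)
      (by fun_prop) (by fun_prop) hTeq
  have hTa : ∀ ω, ∑ i, Fin.append a (0 : Fin dY → ℝ) i * Fin.append (w.X' ω) (w.Y' ω) i =
      ∑ i, a i * w.X' ω i := fun ω => by simp [Fin.sum_univ_add]
  have hfa : ∑ i, Fin.append a (0 : Fin dY → ℝ) i • z i = f := by simp [Fin.sum_univ_add, ha]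
  have hind := indepFun_of_inner_eq_zero hZ' hz' (c := Fin.append a 0) (G := w.G)
    (by simpa only [hfa] using hforth)
  have hTlaw := hz' (Fin.append a 0)
  simp only [hTa, hfa] at hind hTlaw
  refine hind.not_ae_eq_of_nullSingletonClass (by fun_prop) hGZ ?_ hφ hTφ
  rw [hTlaw]
  exact nullSingletonClass_gaussianReal (by simpa using hf0)

/-! ### Ranks and the left null space of a Gram matrix -/

lemma Fin.span_range_eq_sup {H : Type*} [AddCommGroup H] [Module ℝ H] {m n : ℕ}
    (z : Fin (m + n) → H) : Submodule.span ℝ (Set.range z) =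
      Submodule.span ℝ (Set.range fun i => z (Fin.castAdd n i)) ⊔
        Submodule.span ℝ (Set.range fun j => z (Fin.natAdd m j)) := by
  rw [← Submodule.span_union]
  congr 1
  ext v
  simp only [Set.mem_union, Set.mem_range]
  constructor
  · rintro ⟨i, rfl⟩
    exact Fin.addCases (fun i => .inl ⟨i, rfl⟩) (fun j => .inr ⟨j, rfl⟩) i
  · rintro (⟨i, rfl⟩ | ⟨j, rfl⟩)
    exacts [⟨_, rfl⟩, ⟨_, rfl⟩]

lemma Submodule.exists_linearIndependent_span_range_eq {H : Type*} [AddCommGroup H] [Module ℝ H]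
    (W : Submodule ℝ H) [FiniteDimensional ℝ W] : ∃ f : Fin (Module.finrank ℝ W) → H,
      LinearIndependent ℝ f ∧ span ℝ (Set.range f) = W := by
  let b := Module.finBasis ℝ W
  refine ⟨W.subtype ∘ b, b.linearIndependent.map' W.subtype W.ker_subtype, ?_⟩
  rw [Set.range_comp, ← map_span, b.span_eq, map_subtype_top]

section Gram

variable {H : Type*} [NormedAddCommGroup H] [InnerProductSpace ℝ H] [FiniteDimensional ℝ H]
  {m n : ℕ} (z : Fin (m + n) → H)

lemma Matrix.rank_gram_add_finrank_inf :
    (gram ℝ z).rank + Module.finrank ℝ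
      ↑(Submodule.span ℝ (Set.range fun i => z (Fin.castAdd n i)) ⊓
        Submodule.span ℝ (Set.range fun j => z (Fin.natAdd m j))) =
    (gram ℝ fun i => z (Fin.castAdd n i)).rank + (gram ℝ fun j => z (Fin.natAdd m j)).rank := by
  rw [rank_gram, rank_gram, rank_gram, Fin.span_range_eq_sup]
  exact Submodule.finrank_sup_add_finrank_inf_eq _ _

variable {z}

lemma linearIndependent_and_span_eq_of_mul_gram_eq_zero {r : ℕ}
    {N : Matrix (Fin r) (Fin (m + n)) ℝ} {NX : Matrix (Fin r) (Fin m) ℝ}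
    (hx : LinearIndependent ℝ fun i => z (Fin.castAdd n i))
    (hy : LinearIndependent ℝ fun j => z (Fin.natAdd m j))
    (hN : N * Matrix.gram ℝ z = 0) (hrank : N.rank = r)
    (hr : r + (Matrix.gram ℝ z).rank = m + n) (hNX : ∀ i j, NX i j = N i (Fin.castAdd n j)) :
    LinearIndependent ℝ (fun k => ∑ i, NX k i • z (Fin.castAdd n i)) ∧
      Submodule.span ℝ (Set.range fun k => ∑ i, NX k i • z (Fin.castAdd n i)) =
      Submodule.span ℝ (Set.range fun i => z (Fin.castAdd n i)) ⊓
        Submodule.span ℝ (Set.range fun j => z (Fin.natAdd m j)) := by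
  have h0 : ∀ k, ∑ i, N k i • z i = 0 := fun k => by
    have h1 := Matrix.star_dotProduct_gram_mulVec (𝕜 := ℝ) z (N k) (N k)
    have h2 : N k ᵥ* Matrix.gram ℝ z = 0 := congrFun hN k
    rw [star_trivial, Matrix.dotProduct_mulVec, h2, zero_dotProduct] at h1
    exact inner_self_eq_zero.1 h1.symm
  have hsplit : ∀ k, ∑ i, NX k i • z (Fin.castAdd n i) =
      ∑ j, (-N k (Fin.natAdd m j)) • z (Fin.natAdd m j) := fun k => by
    have := h0 k
    rw [Fin.sum_univ_add] at this
    simp only [hNX, neg_smul, Finset.sum_neg_distrib]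
    exact eq_neg_of_add_eq_zero_left this
  have hrows : LinearIndependent ℝ N.row := by
    rw [linearIndependent_iff_card_eq_finrank_span, Fintype.card_fin, Set.finrank,
      ← Matrix.rank_eq_finrank_span_row, hrank]
  have hli : LinearIndependent ℝ (fun k => ∑ i, NX k i • z (Fin.castAdd n i)) := by
    rw [Fintype.linearIndependent_iff] at hx hy ⊢
    intro g hg
    refine Fintype.linearIndependent_iff.1 hrows g (funext fun i => ?_)
    have e1 : ∑ i, (∑ k, g k * NX k i) • z (Fin.castAdd n i) = 0 := by
      rw [← hg]
      simp only [Finset.sum_smul, Finset.smul_sum, smul_smul]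
      exact Finset.sum_comm
    have e2 : ∑ j, (∑ k, g k * -N k (Fin.natAdd m j)) • z (Fin.natAdd m j) = 0 := by
      rw [← hg]
      simp only [hsplit, Finset.sum_smul, Finset.smul_sum, smul_smul]
      exact Finset.sum_comm
    refine Fin.addCases (fun i => ?_) (fun j => ?_) i
    · simpa [hNX] using hx _ e1 i
    · simpa using hy _ e2 j
  refine ⟨hli, Submodule.eq_of_le_of_finrank_eq ?_ ?_⟩
  · rw [Submodule.span_le]
    rintro _ ⟨k, rfl⟩
    exact ⟨sum_smul_mem_span_range _ _, by simp only [hsplit]; exact sum_smul_mem_span_range _ _⟩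
  · have h1 := Matrix.rank_gram_add_finrank_inf z
    rw [Matrix.rank_gram (fun i => z (Fin.castAdd n i)), finrank_span_eq_card hx,
      Matrix.rank_gram (fun j => z (Fin.natAdd m j)), finrank_span_eq_card hy] at h1
    rw [finrank_span_eq_card hli]
    simp only [Fintype.card_fin] at h1 ⊢
    omega

end Gram

/-- **Common information dimension of a pair of jointly Gaussian vectors**
(Theorem 1 of the paper): the set `D` of achievable common-randomness dimensions
(w.r.t. linear functions) is nonempty, its minimum equals
`rank Σ_X + rank Σ_Y − rank Σ`, and when `Σ_X, Σ_Y` are invertible the minimum is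
attained with `G ⬝ [X'; Y'] = N_X ⬝ X'` where `N = [N_X  −N_Y]` is any full-row-rank
matrix whose rows form a basis of the left null space of `Σ`. -/
theorem stmt0 {Ω : Type*} [MeasurableSpace Ω] (P : Measure Ω) [IsProbabilityMeasure P]
    {dX dY : ℕ} (X : Ω → Fin dX → ℝ) (Y : Ω → Fin dY → ℝ)
    (hX : Measurable X) (hY : Measurable Y)
    (hGauss : IsGaussianVec P fun ω => Fin.append (X ω) (Y ω))
    (hmX : ∀ i, ∫ ω, X ω i ∂P = 0) (hmY : ∀ j, ∫ ω, Y ω j ∂P = 0)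
    (K : Matrix (Fin (dX + dY)) (Fin (dX + dY)) ℝ)
    (hK : ∀ i j, K i j = ∫ ω, Fin.append (X ω) (Y ω) i * Fin.append (X ω) (Y ω) j ∂P)
    (KX : Matrix (Fin dX) (Fin dX) ℝ)
    (hKX : ∀ i j, KX i j = ∫ ω, X ω i * X ω j ∂P)
    (KY : Matrix (Fin dY) (Fin dY) ℝ)
    (hKY : ∀ i j, KY i j = ∫ ω, Y ω i * Y ω j ∂P)
    (D : Set ℕ) (hD : ∀ k, k ∈ D ↔ Nonempty (SimWitness P X Y k)) :
    D.Nonempty ∧ sInf D = KX.rank + KY.rank - K.rank ∧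
      (IsUnit KX.det → IsUnit KY.det →
        ∀ (r : ℕ) (N : Matrix (Fin r) (Fin (dX + dY)) ℝ),
          N * K = 0 → N.rank = r → r + K.rank = dX + dY →
          ∀ NX : Matrix (Fin r) (Fin dX) ℝ,
            (∀ i j, NX i j = N i (Fin.castAdd dY j)) →
            r = sInf D ∧
            ∃ w : SimWitness P X Y r,
              ∀ ω, w.G.mulVec (Fin.append (w.X' ω) (w.Y' ω)) = NX.mulVec (w.X' ω)) := by
  have hZ : Measurable fun ω => Fin.append (X ω) (Y ω) := hX.fin_append hY
  obtain ⟨z, rfl, hz⟩ := hGauss.exists_gram hZ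
    (Fin.addCases (fun i => by simpa using hmX i) fun j => by simpa using hmY j) hK
  obtain ⟨x, hx⟩ : ∃ x, x = fun i => z (Fin.castAdd dY i) := ⟨_, rfl⟩
  obtain ⟨y, hy⟩ : ∃ y, y = fun j => z (Fin.natAdd dX j) := ⟨_, rfl⟩
  obtain rfl : KX = gram ℝ x := by
    ext i j
    simpa [hKX, hx, gram_apply] using (hK (Fin.castAdd dY i) (Fin.castAdd dY j)).symm
  obtain rfl : KY = gram ℝ y := by
    ext i j
    simpa [hKY, hy, gram_apply] using (hK (Fin.natAdd dX i) (Fin.natAdd dX j)).symm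
  have hlaw : ∀ Λ : StrongDual ℝ ((Fin dX → ℝ) × (Fin dY → ℝ)),
      charFunDual (P.map fun ω => (X ω, Y ω)) Λ = Complex.exp (-((‖∑ i, Λ (Pi.single i 1, 0) • x i +
        ∑ j, Λ (0, Pi.single j 1) • y j‖ ^ 2 : ℝ) : ℂ) / 2) := by
    rw [hx, hy]
    exact charFunDual_map_prodMk hX hY hz
  have hrank := rank_gram_add_finrank_inf z
  have hle : ∀ k ∈ D, _ := fun k hk => ((hD k).1 hk).some.finrank_le hX hY hz
  rw [← hx, ← hy] at hrank hle
  obtain ⟨f, hfli, hfspan⟩ := Submodule.exists_linearIndependent_span_range_eq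
    (Submodule.span ℝ (Set.range x) ⊓ Submodule.span ℝ (Set.range y))
  choose NX hNX using fun k => (Submodule.mem_span_range_iff_exists_fun ℝ).1
    (hfspan.le (Submodule.subset_span (Set.mem_range_self k))).1
  have hmem : Module.finrank ℝ
      ↑(Submodule.span ℝ (Set.range x) ⊓ Submodule.span ℝ (Set.range y)) ∈ D := by
    obtain ⟨w, -⟩ := exists_simWitness_of_basis hX hY hlaw (fun k => (hNX k).symm) hfli hfspan
    exact (hD _).2 ⟨w⟩
  have hmin : sInf D = Module.finrank ℝ
      ↑(Submodule.span ℝ (Set.range x) ⊓ Submodule.span ℝ (Set.range y)) :=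
    le_antisymm (Nat.sInf_le hmem) (hle _ (Nat.sInf_mem ⟨_, hmem⟩))
  refine ⟨⟨_, hmem⟩, by omega, fun hKXu hKYu r N hNK hNr hrK NX hNX => ?_⟩
  have hxli := det_gram_ne_zero_iff_linearIndependent.1 hKXu.ne_zero
  have hyli := det_gram_ne_zero_iff_linearIndependent.1 hKYu.ne_zero
  rw [hx] at hxli
  rw [hy] at hyli
  obtain ⟨hli, hspan⟩ := linearIndependent_and_span_eq_of_mul_gram_eq_zero hxli hyli hNK hNr hrK hNX
  have hr := finrank_span_eq_card hli
  rw [hspan, Fintype.card_fin, ← hx, ← hy] at hr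
  refine ⟨hr.symm.trans hmin.symm, exists_simWitness_of_basis hX hY hlaw (fun k => ?_) hli ?_⟩
  · rw [hx]
  · rw [hspan, hx, hy]

end
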